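/- arXiv:2002.01654 — 2 statements merged into one kernel-verified Lean document; each statement's English description precedes it below -/
import Mathlib

section
/- Let k be a positive integer. If α > 1 and β > 1 satisfy a(α) = b(β) − (2k−1)π and |I(α)| = |F(β)|, then I(α) = F(−β) = −F(β), and the function u : [0,d] → ℝ defined by u(t) = u_α(t) for t ∈ [0,t₀] and u(t) = u*_{−β}(t) for t ∈ [t₀,d] belongs to C¹([0,d]) ∩ C²((0,d)), satisfies equation (★) on (0,d), satisfies u'(0) = u'(d) = 0, and has exactly 2k−1 zeros in the open interval (0,d). -/
open Set Filter

/-- `u` is a solution of the ODE `u'' + h u' + λ(|u|^{q-1} u - u) = 0`,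
being C¹ on the closed set `S` (with derivative `u'`) and C² on `Sint`
(with second derivative `u''`), where the equation holds on `Sint`. -/
def SolOn (h : ℝ → ℝ) (lam q : ℝ) (S Sint : Set ℝ) (u u' u'' : ℝ → ℝ) : Prop :=
  (∀ t ∈ S, HasDerivWithinAt u (u' t) S t) ∧
  ContinuousOn u' S ∧
  (∀ t ∈ Sint, HasDerivWithinAt u' (u'' t) Sint t) ∧
  ContinuousOn u'' Sint ∧
  (∀ t ∈ Sint, u'' t + h t * u' t + lam * (|u t| ^ (q - 1) * u t - u t) = 0)

/-- The Euclidean norm on ℝ². -/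
noncomputable def enorm2 (p : ℝ × ℝ) : ℝ := Real.sqrt (p.1 ^ 2 + p.2 ^ 2)

open Topology

theorem le_mul_exp_of_hasDerivAt_le {D D' : ℝ → ℝ} {s r C : ℝ}
    (hc : ContinuousOn D (Icc s r)) (hd : ∀ t ∈ Ioo s r, HasDerivAt D (D' t) t)
    (hle : ∀ t ∈ Ioo s r, D' t ≤ C * D t) {t : ℝ} (ht : t ∈ Icc s r) :
    D t ≤ D s * Real.exp (C * (t - s)) := by
  have hanti : AntitoneOn (fun x => D x * Real.exp (-C * (x - s))) (Icc s r) := by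
    refine antitoneOn_of_hasDerivWithinAt_nonpos (convex_Icc s r) (hc.mul (by fun_prop))
      (f' := fun x => (D' x - C * D x) * Real.exp (-C * (x - s))) ?_ ?_
    · intro x hx
      rw [interior_Icc] at hx
      have h1 : HasDerivAt (fun x => Real.exp (-C * (x - s)))
          (Real.exp (-C * (x - s)) * (-C * 1)) x :=
        (((hasDerivAt_id x).sub_const s).const_mul (-C)).exp
      exact (((hd x hx).mul h1).congr_deriv (by ring)).hasDerivWithinAt
    · intro x hx
      rw [interior_Icc] at hx
      exact mul_nonpos_of_nonpos_of_nonneg (by linarith [hle x hx]) (Real.exp_pos _).le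
  have h1 := hanti (left_mem_Icc.2 (ht.1.trans ht.2)) ht ht.1
  simp only [sub_self, mul_zero, Real.exp_zero, mul_one] at h1
  calc D t = D t * Real.exp (-C * (t - s)) * Real.exp (C * (t - s)) := by
        rw [mul_assoc, ← Real.exp_add]; simp
    _ ≤ _ := mul_le_mul_of_nonneg_right h1 (Real.exp_pos _).le

theorem le_mul_exp_of_le_hasDerivAt {D D' : ℝ → ℝ} {s r C : ℝ}
    (hc : ContinuousOn D (Icc s r)) (hd : ∀ t ∈ Ioo s r, HasDerivAt D (D' t) t)
    (hle : ∀ t ∈ Ioo s r, -(C * D t) ≤ D' t) {t : ℝ} (ht : t ∈ Icc s r) :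
    D t ≤ D r * Real.exp (C * (r - t)) := by
  have hmem : ∀ x ∈ Ioo (-r) (-s), -x ∈ Ioo s r := fun x hx =>
    ⟨by linarith [hx.2], by linarith [hx.1]⟩
  have key := le_mul_exp_of_hasDerivAt_le (D := fun x => D (-x)) (D' := fun x => -D' (-x))
    (s := -r) (r := -s) (C := C) (t := -t)
    (hc.comp (by fun_prop) fun x hx => ⟨by linarith [hx.2], by linarith [hx.1]⟩)
    (fun x hx => ((hd (-x) (hmem x hx)).scomp x (hasDerivAt_neg x)).congr_deriv (by simp))
    (fun x hx => by linarith [hle (-x) (hmem x hx)])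
    ⟨by linarith [ht.2], by linarith [ht.1]⟩
  rw [neg_neg, neg_neg] at key
  rwa [show r - t = -t - -r by ring]

theorem exists_lipschitz_rpow {q : ℝ} (hq : 1 ≤ q) (A : ℝ) :
    ∃ L, 0 ≤ L ∧ ∀ x ∈ Icc 0 A, ∀ y ∈ Icc 0 A, |x ^ q - y ^ q| ≤ L * |x - y| := by
  refine ⟨q * |A| ^ (q - 1), by positivity, fun x hx y hy => ?_⟩
  have := (convex_Icc (0 : ℝ) A).norm_image_sub_le_of_norm_hasDerivWithin_le
    (f := fun x => x ^ q) (f' := fun x => q * x ^ (q - 1)) (C := q * |A| ^ (q - 1))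
    (fun z hz => (Real.hasDerivAt_rpow_const (Or.inr hq)).hasDerivWithinAt)
    (fun z hz => by
      rw [Real.norm_of_nonneg (mul_nonneg (by linarith) (Real.rpow_nonneg hz.1 _))]
      exact mul_le_mul_of_nonneg_left (Real.rpow_le_rpow hz.1 (hz.2.trans (le_abs_self A))
        (by linarith)) (by linarith)) hy hx
  simpa using this

theorem abs_rpow_sub_one_mul_self_eq {q : ℝ} (hq : 0 < q) (x : ℝ) :
    |x| ^ (q - 1) * x = (max x 0) ^ q - (max (-x) 0) ^ q := by
  rcases lt_trichotomy x 0 with hx | rfl | hx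
  · rw [max_eq_right hx.le, max_eq_left (by linarith), abs_of_neg hx, Real.zero_rpow hq.ne',
      Real.rpow_sub_one (by linarith)]
    have := hx.ne
    field_simp
    ring
  · simp
  · rw [max_eq_left hx.le, max_eq_right (by linarith), abs_of_pos hx, Real.zero_rpow hq.ne',
      Real.rpow_sub_one hx.ne']
    field_simp
    ring

theorem exists_lipschitz_nonlinearity {q : ℝ} (hq : 1 < q) (A : ℝ) :
    ∃ L, 0 ≤ L ∧ ∀ x y, |x| ≤ A → |y| ≤ A →
      |(|x| ^ (q - 1) * x - x) - (|y| ^ (q - 1) * y - y)| ≤ L * |x - y| := by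
  obtain ⟨L, hL, hLip⟩ := exists_lipschitz_rpow hq.le A
  refine ⟨2 * L + 1, by linarith, fun x y hx hy => ?_⟩
  rw [abs_rpow_sub_one_mul_self_eq (by linarith), abs_rpow_sub_one_mul_self_eq (by linarith)]
  have hmem : ∀ z, |z| ≤ A → max z 0 ∈ Icc 0 A := fun z hz =>
    ⟨le_max_right _ _, max_le ((le_abs_self z).trans hz) ((abs_nonneg z).trans hz)⟩
  have h1 := (hLip _ (hmem x hx) _ (hmem y hy)).trans
    (mul_le_mul_of_nonneg_left (abs_max_sub_max_le_abs x y 0) hL)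
  have h2 := (hLip _ (hmem (-x) (by rwa [abs_neg])) _ (hmem (-y) (by rwa [abs_neg]))).trans
    (mul_le_mul_of_nonneg_left (abs_max_sub_max_le_abs (-x) (-y) 0) hL)
  rw [show -x - -y = -(x - y) by ring, abs_neg] at h2
  rw [abs_le] at h1 h2 ⊢
  have h3 := le_abs_self (x - y)
  have h4 := neg_abs_le (x - y)
  constructor <;> nlinarith [h1.1, h1.2, h2.1, h2.2]

/-- The potential whose derivative is the nonlinearity `|s|^{q-1} s - s`. -/
noncomputable def potential (q s : ℝ) : ℝ := |s| ^ (q + 1) / (q + 1) - s ^ 2 / 2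

theorem hasDerivAt_potential {q : ℝ} (hq : 0 < q) (s : ℝ) :
    HasDerivAt (potential q) (|s| ^ (q - 1) * s - s) s := by
  have h1 := (hasDerivAt_abs_rpow s (p := q + 1) (by linarith)).div_const (q + 1)
  have h2 := (hasDerivAt_pow 2 s).div_const 2
  refine (h1.sub h2).congr_deriv ?_
  rw [show q + 1 - 2 = q - 1 by ring]
  field_simp
  push_cast
  ring

theorem strictMonoOn_potential {q : ℝ} (hq : 1 < q) : StrictMonoOn (potential q) (Ici 1) := by
  refine strictMonoOn_of_deriv_pos (convex_Ici 1)
    (fun s _ => (hasDerivAt_potential (by linarith) s).continuousAt.continuousWithinAt) ?_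
  intro s hs
  rw [interior_Ici] at hs
  have hs : 1 < s := hs
  rw [(hasDerivAt_potential (by linarith) s).deriv, abs_of_pos (by linarith)]
  nlinarith [Real.one_lt_rpow hs (by linarith : 0 < q - 1)]

theorem abs_le_of_potential_le {q : ℝ} (hq : 1 < q) {s A : ℝ} (hA : 1 ≤ A)
    (h : potential q s ≤ potential q A) : |s| ≤ A := by
  by_contra! hlt
  have h1 := strictMonoOn_potential hq (mem_Ici.2 hA) (mem_Ici.2 (hA.trans hlt.le)) hlt
  have h2 : potential q |s| = potential q s := by simp [potential]
  linarith

section HalfSolution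

variable {h : ℝ → ℝ} {lam q T : ℝ}

theorem SolOn.hasDerivAt {u u' u'' : ℝ → ℝ}
    (hs : SolOn h lam q (Icc 0 T) (Ioc 0 T) u u' u'') {t : ℝ} (ht : t ∈ Ioo 0 T) :
    HasDerivAt u (u' t) t :=
  (hs.1 t ⟨ht.1.le, ht.2.le⟩).hasDerivAt (Icc_mem_nhds ht.1 ht.2)

theorem SolOn.hasDerivAt_deriv {u u' u'' : ℝ → ℝ}
    (hs : SolOn h lam q (Icc 0 T) (Ioc 0 T) u u' u'') {t : ℝ} (ht : t ∈ Ioo 0 T) :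
    HasDerivAt u' (-h t * u' t - lam * (|u t| ^ (q - 1) * u t - u t)) t := by
  have h1 := hs.2.2.2.2 t ⟨ht.1, ht.2.le⟩
  exact ((hs.2.2.1 t ⟨ht.1, ht.2.le⟩).hasDerivAt (Ioc_mem_nhds ht.1 ht.2)).congr_deriv
    (by linarith)

theorem SolOn.continuousOn {S S' : Set ℝ} {u u' u'' : ℝ → ℝ}
    (hs : SolOn h lam q S S' u u' u'') : ContinuousOn u S :=
  fun t ht => (hs.1 t ht).continuousWithinAt

theorem SolOn.abs_le (hlam : 0 < lam) (hq : 1 < q) (hh : ∀ t ∈ Ioo 0 T, 0 ≤ h t)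
    {u u' u'' : ℝ → ℝ} (hs : SolOn h lam q (Icc 0 T) (Ioc 0 T) u u' u'')
    (h1 : 1 ≤ u 0) (h0 : u' 0 = 0) {t : ℝ} (ht : t ∈ Icc 0 T) : |u t| ≤ u 0 := by
  have hcp : Continuous (potential q) := continuous_iff_continuousAt.2 fun s =>
    (hasDerivAt_potential (by linarith) s).continuousAt
  have key := le_mul_exp_of_hasDerivAt_le (s := 0) (r := T) (C := 0)
    (D := fun t => u' t ^ 2 / 2 + lam * potential q (u t)) (D' := fun t => -h t * u' t ^ 2)
    (((hs.2.1.pow 2).div_const 2).add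
      (continuousOn_const.mul (hcp.comp_continuousOn hs.continuousOn)))
    (fun t ht => by
      have e1 := ((hs.hasDerivAt_deriv ht).pow 2).div_const 2
      have e2 := ((hasDerivAt_potential (by linarith : 0 < q) (u t)).comp t
        (hs.hasDerivAt ht)).const_mul lam
      refine (e1.add e2).congr_deriv ?_
      simp only [Nat.add_one_sub_one, pow_one, Nat.cast_ofNat]
      ring)
    (fun t ht => by nlinarith [hh t ht, mul_nonneg (hh t ht) (sq_nonneg (u' t))]) ht
  simp only [zero_mul, Real.exp_zero, mul_one, h0] at key
  refine abs_le_of_potential_le hq h1 (le_of_mul_le_mul_left (a := lam) ?_ hlam)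
  nlinarith [sq_nonneg (u' t)]

theorem exists_dist_sq_le (hlam : 0 < lam) (hq : 1 < q) (hh : ∀ t ∈ Ioo 0 T, 0 ≤ h t) (A : ℝ) :
    ∃ C, ∀ u u' u'' v v' v'' : ℝ → ℝ,
      SolOn h lam q (Icc 0 T) (Ioc 0 T) u u' u'' → SolOn h lam q (Icc 0 T) (Ioc 0 T) v v' v'' →
      1 ≤ u 0 → u 0 ≤ A → u' 0 = 0 → 1 ≤ v 0 → v 0 ≤ A → v' 0 = 0 →
      ∀ t ∈ Icc 0 T, (u t - v t) ^ 2 + (u' t - v' t) ^ 2 ≤ (u 0 - v 0) ^ 2 * C := by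
  obtain ⟨L, hL, hLip⟩ := exists_lipschitz_nonlinearity hq A
  refine ⟨Real.exp ((1 + lam * L) * T), ?_⟩
  intro u u' u'' v v' v'' hu hv hu1 huA hu0 hv1 hvA hv0 t ht
  have key := le_mul_exp_of_hasDerivAt_le (s := 0) (r := T) (C := 1 + lam * L)
    (D := fun t => (u t - v t) ^ 2 + (u' t - v' t) ^ 2)
    (D' := fun t => 2 * (u t - v t) * (u' t - v' t) + 2 * (u' t - v' t) *
      ((-h t * u' t - lam * (|u t| ^ (q - 1) * u t - u t)) -
        (-h t * v' t - lam * (|v t| ^ (q - 1) * v t - v t))))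
    (((hu.continuousOn.sub hv.continuousOn).pow 2).add ((hu.2.1.sub hv.2.1).pow 2))
    (fun t ht => by
      have e1 := ((hu.hasDerivAt ht).sub (hv.hasDerivAt ht)).pow 2
      have e2 := ((hu.hasDerivAt_deriv ht).sub (hv.hasDerivAt_deriv ht)).pow 2
      refine (e1.add e2).congr_deriv ?_
      simp)
    (fun t ht => by
      have ht' : t ∈ Icc 0 T := ⟨ht.1.le, ht.2.le⟩
      have hl := hLip (u t) (v t) ((hu.abs_le hlam hq hh hu1 hu0 ht').trans huA)
        ((hv.abs_le hlam hq hh hv1 hv0 ht').trans hvA)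
      set x := u t - v t
      set y := u' t - v' t
      set g := (|u t| ^ (q - 1) * u t - u t) - (|v t| ^ (q - 1) * v t - v t) with hg
      have hgy : -(g * y) ≤ L * (x ^ 2 + y ^ 2) / 2 := by
        have i1 : |g * y| ≤ L * |x| * |y| := by
          rw [abs_mul]; exact mul_le_mul_of_nonneg_right hl (abs_nonneg y)
        have i2 : |x| * |y| ≤ (x ^ 2 + y ^ 2) / 2 := by
          nlinarith [sq_nonneg (|x| - |y|), sq_abs x, sq_abs y]
        nlinarith [neg_abs_le (g * y), mul_le_mul_of_nonneg_left i2 hL]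
      have e : 2 * x * y + 2 * y * ((-h t * u' t - lam * (|u t| ^ (q - 1) * u t - u t)) -
          (-h t * v' t - lam * (|v t| ^ (q - 1) * v t - v t))) =
          2 * x * y - 2 * (h t * y ^ 2) + 2 * lam * -(g * y) := by
        simp only [hg, y]; ring
      have i3 := mul_nonneg (hh t ht) (sq_nonneg y)
      have i4 := mul_le_mul_of_nonneg_left hgy hlam.le
      change 2 * x * y + _ ≤ (1 + lam * L) * (x ^ 2 + y ^ 2)
      rw [e]
      nlinarith [sq_nonneg (x - y)]) ht
  simp only [hu0, hv0, sub_zero, ne_eq, OfNat.ofNat_ne_zero, not_false_eq_true, zero_pow, add_zero,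
    sub_self] at key
  refine key.trans (mul_le_mul_of_nonneg_left (Real.exp_le_exp.2 ?_) (sq_nonneg _))
  exact mul_le_mul_of_nonneg_left ht.2 (by positivity)

theorem SolOn.sq_add_sq_pos (hlam : 0 < lam) (hq : 1 < q) (hc : ContinuousOn h (Ioc 0 T))
    (hh : ∀ t ∈ Ioo 0 T, 0 ≤ h t)
    {u u' u'' : ℝ → ℝ} (hs : SolOn h lam q (Icc 0 T) (Ioc 0 T) u u' u'')
    (h1 : 1 ≤ u 0) (h0 : u' 0 = 0) {t : ℝ} (ht : t ∈ Icc 0 T) : 0 < u t ^ 2 + u' t ^ 2 := by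
  by_contra! hle
  have hz : u t ^ 2 + u' t ^ 2 = 0 := le_antisymm hle (by positivity)
  have hcont : ContinuousOn (fun s => u s ^ 2 + u' s ^ 2) (Icc 0 T) :=
    (hs.continuousOn.pow 2).add (hs.2.1.pow 2)
  have ht0 : 0 < t := by
    rcases ht.1.eq_or_lt with rfl | h
    · rw [h0] at hz; nlinarith
    · exact h
  obtain ⟨L, hL, hLip⟩ := exists_lipschitz_nonlinearity hq (u 0)
  have hzero : ∀ s ∈ Ioc 0 t, u s ^ 2 + u' s ^ 2 = 0 := by
    intro s hs'
    have hsub : Icc s t ⊆ Ioc 0 T := fun x hx => ⟨hs'.1.trans_le hx.1, hx.2.trans ht.2⟩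
    obtain ⟨B, hB⟩ := isCompact_Icc.exists_bound_of_continuousOn (hc.mono hsub)
    have key := le_mul_exp_of_le_hasDerivAt (s := s) (r := t) (C := 1 + 2 * B + lam * L)
      (D := fun t => u t ^ 2 + u' t ^ 2)
      (D' := fun t => 2 * u t * u' t + 2 * u' t *
        (-h t * u' t - lam * (|u t| ^ (q - 1) * u t - u t)))
      (hcont.mono (hsub.trans Ioc_subset_Icc_self))
      (fun x hx => by
        have hx' : x ∈ Ioo 0 T := ⟨hs'.1.trans hx.1, hx.2.trans_le ht.2⟩
        have e1 := (hs.hasDerivAt hx').pow 2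
        have e2 := (hs.hasDerivAt_deriv hx').pow 2
        refine (e1.add e2).congr_deriv ?_
        simp)
      (fun x hx => by
        have hx' : x ∈ Icc 0 T := ⟨(hs'.1.trans hx.1).le, (hx.2.trans_le ht.2).le⟩
        have hl := hLip (u x) 0 (hs.abs_le hlam hq hh h1 h0 hx') (by rw [abs_zero]; linarith)
        have hb := (le_abs_self _).trans (hB x ⟨hx.1.le, hx.2.le⟩)
        simp only [mul_zero, sub_zero] at hl
        set g := |u x| ^ (q - 1) * u x - u x
        set y := u' x
        have hgy : g * y ≤ L * (u x ^ 2 + y ^ 2) / 2 := by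
          have i1 : |g * y| ≤ L * |u x| * |y| := by
            rw [abs_mul]; exact mul_le_mul_of_nonneg_right hl (abs_nonneg y)
          have i2 : |u x| * |y| ≤ (u x ^ 2 + y ^ 2) / 2 := by
            nlinarith [sq_nonneg (|u x| - |y|), sq_abs (u x), sq_abs y]
          nlinarith [le_abs_self (g * y), mul_le_mul_of_nonneg_left i2 hL]
        have i3 := mul_le_mul_of_nonneg_right hb (sq_nonneg y)
        have i4 := mul_le_mul_of_nonneg_left hgy hlam.le
        have hB0 : 0 ≤ B := (norm_nonneg _).trans (hB x ⟨hx.1.le, hx.2.le⟩)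
        have i5 := mul_nonneg hB0 (sq_nonneg (u x))
        nlinarith [sq_nonneg (u x + y)]) (left_mem_Icc.2 hs'.2)
    simp only [hz, zero_mul] at key
    exact le_antisymm key (by positivity)
  have hlim : Tendsto (fun s => u s ^ 2 + u' s ^ 2) (𝓝[Ioc 0 t] 0) (𝓝 (u 0 ^ 2 + u' 0 ^ 2)) :=
    (hcont 0 ⟨le_rfl, ht.1.trans ht.2⟩).mono
      fun x hx => ⟨hx.1.le, hx.2.trans ht.2⟩
  have hne : (𝓝[Ioc 0 t] (0 : ℝ)).NeBot := by
    rw [nhdsWithin_Ioc_eq_nhdsGT ht0]; infer_instance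
  have hlim' : Tendsto (fun s => u s ^ 2 + u' s ^ 2) (𝓝[Ioc 0 t] 0) (𝓝 0) :=
    tendsto_const_nhds.congr' (by
      filter_upwards [self_mem_nhdsWithin] with s hs'
      exact (hzero s hs').symm)
  have := tendsto_nhds_unique hlim hlim'
  rw [h0] at this
  nlinarith

end HalfSolution

section Counting

variable {T : ℝ} {θ : ℝ → ℝ}

theorem lt_of_downward_crossing (hθ : ContinuousOn θ (Icc 0 T))
    (hR : ∀ s ∈ Ico 0 T, Real.cos (θ s) = 0 → ∀ᶠ t in 𝓝[>] s, θ t < θ s)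
    (hL : ∀ s ∈ Ioc 0 T, Real.cos (θ s) = 0 → ∀ᶠ t in 𝓝[<] s, θ s < θ t)
    {c t₁ t₂ : ℝ} (hc : Real.cos c = 0) (h0 : 0 ≤ t₁) (h12 : t₁ < t₂) (h2 : t₂ ≤ T)
    (hle : θ t₁ ≤ c) : θ t₂ < c := by
  by_contra! hge
  obtain ⟨a, ha1, ha2, hac⟩ : ∃ a, t₁ ≤ a ∧ a < t₂ ∧ θ a < c := by
    rcases hle.eq_or_lt with heq | hlt
    · have hev := hR t₁ ⟨h0, h12.trans_le h2⟩ (by rw [heq, hc])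
      obtain ⟨a, ha, ha'⟩ := (hev.and (Ioo_mem_nhdsGT h12)).exists
      exact ⟨a, ha'.1.le, ha'.2, heq ▸ ha⟩
    · exact ⟨t₁, le_rfl, h12, hlt⟩
  have hsub : Icc a t₂ ⊆ Icc 0 T := Icc_subset_Icc (h0.trans ha1) h2
  have hcpt : IsCompact (Icc a t₂ ∩ θ ⁻¹' Ici c) :=
    isCompact_Icc.of_isClosed_subset
      ((hθ.mono hsub).preimage_isClosed_of_isClosed isClosed_Icc isClosed_Ici) inter_subset_left
  obtain ⟨s, ⟨hs1, hs2⟩, hmin⟩ := hcpt.exists_isLeast ⟨t₂, ⟨ha2.le, le_rfl⟩, hge⟩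
  have hs2 : c ≤ θ s := hs2
  have has : a < s := hs1.1.lt_of_ne fun e => by rw [e] at hac; linarith
  have hsc : θ s = c := by
    obtain ⟨x, hx, hxc⟩ := intermediate_value_Icc has.le
      (hθ.mono ((Icc_subset_Icc_right hs1.2).trans hsub)) ⟨hac.le, hs2⟩
    have : s ≤ x := hmin ⟨⟨hx.1, hx.2.trans hs1.2⟩, hxc.ge⟩
    rw [← hxc, le_antisymm this hx.2]
  have hev := hL s ⟨(h0.trans ha1).trans_lt has, hs1.2.trans h2⟩ (by rw [hsc, hc])
  obtain ⟨x, hx, hx'⟩ := (hev.and (Ioo_mem_nhdsLT has)).exists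
  rw [hsc] at hx
  exact absurd (hmin ⟨⟨hx'.1.le, hx'.2.le.trans hs1.2⟩, hx.le⟩) (not_le.2 hx'.2)

theorem exists_ncard_cos_zeros (hT : 0 < T) (hθ : ContinuousOn θ (Icc 0 T)) (hθ0 : θ 0 = 0)
    (hR : ∀ s ∈ Ico 0 T, Real.cos (θ s) = 0 → ∀ᶠ t in 𝓝[>] s, θ t < θ s)
    (hL : ∀ s ∈ Ioc 0 T, Real.cos (θ s) = 0 → ∀ᶠ t in 𝓝[<] s, θ s < θ t) :
    ∃ N : ℕ, {t ∈ Ioc 0 T | Real.cos (θ t) = 0}.Finite ∧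
      {t ∈ Ioc 0 T | Real.cos (θ t) = 0}.ncard = N ∧
      θ T ≤ Real.pi / 2 - N * Real.pi ∧ -(Real.pi / 2) - N * Real.pi < θ T := by
  have hpi := Real.pi_pos
  have hup : ∀ t ∈ Ioc 0 T, θ t < Real.pi / 2 := fun t ht =>
    lt_of_downward_crossing hθ hR hL Real.cos_pi_div_two le_rfl ht.1 ht.2 (by rw [hθ0]; positivity)
  have hTup := hup T ⟨hT, le_rfl⟩
  have hcos : ∀ j : ℕ, Real.cos (-(Real.pi / 2) - j * Real.pi) = 0 := fun j => by
    rw [Real.cos_eq_zero_iff]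
    exact ⟨-1 - j, by push_cast; ring⟩
  set N := ⌊(Real.pi / 2 - θ T) / Real.pi⌋₊ with hN
  have hN1 : (N : ℝ) * Real.pi ≤ Real.pi / 2 - θ T :=
    (le_div_iff₀ hpi).1 (Nat.floor_le (div_nonneg (by linarith) hpi.le))
  have hN2 : Real.pi / 2 - θ T < (N + 1) * Real.pi := (div_lt_iff₀ hpi).1 (Nat.lt_floor_add_one _)
  have hex : ∀ j : ℕ, j < N → ∃ t ∈ Ioc 0 T, θ t = -(Real.pi / 2) - j * Real.pi := by
    intro j hj
    have hj1 : ((j : ℝ) + 1) * Real.pi ≤ N * Real.pi :=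
      mul_le_mul_of_nonneg_right (by exact_mod_cast hj) hpi.le
    have hj0 : (0 : ℝ) ≤ j * Real.pi := by positivity
    obtain ⟨t, ht, hte⟩ := intermediate_value_Icc' hT.le hθ
      (show -(Real.pi / 2) - j * Real.pi ∈ Icc (θ T) (θ 0) from
        ⟨by linarith, by rw [hθ0]; linarith⟩)
    refine ⟨t, ⟨ht.1.lt_of_ne fun e => ?_, ht.2⟩, hte⟩
    rw [← e, hθ0] at hte
    linarith
  choose! f hf hfθ using hex
  have himage : {t ∈ Ioc 0 T | Real.cos (θ t) = 0} = f '' Iio N := by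
    ext t
    constructor
    · rintro ⟨ht, htc⟩
      obtain ⟨m, hm⟩ := Real.cos_eq_zero_iff.1 htc
      have hm0 : m < 0 := by
        have h1 := hup t ht
        rw [hm] at h1
        have h2 : (m : ℝ) * Real.pi < 0 := by linarith
        exact_mod_cast neg_of_mul_neg_left h2 hpi.le
      obtain ⟨j, rfl⟩ : ∃ j : ℕ, m = -1 - j := ⟨(-1 - m).toNat, by omega⟩
      have hte : θ t = -(Real.pi / 2) - j * Real.pi := by rw [hm]; push_cast; ring
      have hTle : θ T ≤ -(Real.pi / 2) - j * Real.pi := by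
        rcases ht.2.eq_or_lt with rfl | hlt
        · exact hte.le
        · exact (lt_of_downward_crossing hθ hR hL (hcos j) ht.1.le hlt le_rfl hte.le).le
      have hjN : j < N := by
        have : ((j : ℝ) + 1) * Real.pi < (N + 1) * Real.pi := by linarith
        have := lt_of_mul_lt_mul_right this hpi.le
        exact_mod_cast (by linarith : (j : ℝ) < N)
      refine ⟨j, hjN, ?_⟩
      by_contra hne
      rcases lt_or_gt_of_ne hne with hlt | hlt
      · have := lt_of_downward_crossing hθ hR hL (hcos j) (hf j hjN).1.le hlt ht.2 (hfθ j hjN).le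
        linarith
      · have := lt_of_downward_crossing hθ hR hL (hcos j) ht.1.le hlt (hf j hjN).2 hte.le
        linarith [hfθ j hjN]
    · rintro ⟨j, hj, rfl⟩
      exact ⟨hf j hj, by rw [hfθ j hj, hcos]⟩
  have hinj : InjOn f (Iio N) := by
    intro i hi j hj hij
    have h1 := hfθ i hi
    rw [hij, hfθ j hj] at h1
    have : (i : ℝ) = j := mul_right_cancel₀ hpi.ne' (by linarith)
    exact_mod_cast this
  refine ⟨N, ?_, ?_, by linarith, by linarith⟩
  · rw [himage]; exact (finite_Iio N).image f
  · rw [himage, hinj.ncard_image, ← Finset.coe_Iio, ncard_coe_finset, Nat.card_Iio]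

theorem eventually_mul_slope_pos {u : ℝ → ℝ} {c s : ℝ} {S : Set ℝ} (hu : HasDerivWithinAt u c S s)
    (hS : s ∉ S) (h0 : u s = 0) (hc : c ≠ 0) : ∀ᶠ t in 𝓝[S] s, 0 < u t * c * (t - s) := by
  have h1 := ((hasDerivWithinAt_iff_tendsto_slope' hS).1 hu).mul_const c
  filter_upwards [h1.eventually_const_lt (mul_self_pos.2 hc), self_mem_nhdsWithin] with t ht htS
  have hne : t - s ≠ 0 := sub_ne_zero.2 fun e => hS (e ▸ htS)
  rw [slope_def_field, h0, sub_zero] at ht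
  have h2 : u t * c * (t - s) = u t / (t - s) * c * (t - s) ^ 2 := by field_simp
  rw [h2]
  positivity

theorem eventually_mul_sub_neg_of_polar {u u' r : ℝ → ℝ} {S : Set ℝ} {s : ℝ} (hr : ∀ t, 0 < r t)
    (hS : s ∉ S) (hu : HasDerivWithinAt u (u' s) S s) (hθ : ContinuousWithinAt θ S s)
    (hcos : ∀ᶠ t in 𝓝[S] s, u t = r t * Real.cos (θ t)) (hcoss : u s = r s * Real.cos (θ s))
    (hsin : u' s = r s * Real.sin (θ s)) (hz : Real.cos (θ s) = 0) :
    ∀ᶠ t in 𝓝[S] s, (θ t - θ s) * (t - s) < 0 := by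
  have hs0 : Real.sin (θ s) ≠ 0 := fun e => by
    have := Real.sin_sq_add_cos_sq (θ s)
    rw [e, hz] at this
    norm_num at this
  have h1 := eventually_mul_slope_pos hu hS (by rw [hcoss, hz, mul_zero])
    (by rw [hsin]; exact mul_ne_zero (hr s).ne' hs0)
  have h2 : ∀ᶠ t in 𝓝[S] s, θ t ∈ Ioo (θ s - Real.pi) (θ s + Real.pi) :=
    hθ (Ioo_mem_nhds (by linarith [Real.pi_pos]) (by linarith [Real.pi_pos]))
  filter_upwards [h1, h2, hcos] with t ht1 ht2 ht3
  have e : Real.sin (θ t - θ s) = -(Real.cos (θ t) * Real.sin (θ s)) := by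
    rw [Real.sin_sub, hz]; ring
  have hpos : 0 < (r t * r s) * (Real.cos (θ t) * Real.sin (θ s) * (t - s)) := by
    rw [ht3, hsin] at ht1
    linarith
  have hpos' := pos_of_mul_pos_right hpos (mul_pos (hr t) (hr s)).le
  have hneg : Real.sin (θ t - θ s) * (t - s) < 0 := by rw [e]; linarith
  by_contra! hge
  rcases lt_trichotomy t s with hts | rfl | hts
  · have : θ t - θ s ≤ 0 := nonpos_of_mul_nonneg_left hge (by linarith)
    have := Real.sin_nonpos_of_nonpos_of_neg_pi_le this (by linarith [ht2.1])
    nlinarith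
  · simp at hneg
  · have : 0 ≤ θ t - θ s := nonneg_of_mul_nonneg_left hge (by linarith)
    have := Real.sin_nonneg_of_nonneg_of_le_pi this (by linarith [ht2.2])
    nlinarith

theorem exists_ncard_zeros_of_polar {u u' r : ℝ → ℝ} (hT : 0 < T) (hr : ∀ t, 0 < r t)
    (hu : ∀ t ∈ Icc 0 T, HasDerivWithinAt u (u' t) (Icc 0 T) t)
    (hθ : ContinuousOn θ (Icc 0 T)) (hθ0 : θ 0 = 0)
    (hcos : ∀ t ∈ Icc 0 T, u t = r t * Real.cos (θ t))
    (hsin : ∀ t ∈ Icc 0 T, u' t = r t * Real.sin (θ t)) :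
    ∃ N : ℕ, {t ∈ Ioc 0 T | u t = 0}.Finite ∧ {t ∈ Ioc 0 T | u t = 0}.ncard = N ∧
      θ T ≤ Real.pi / 2 - N * Real.pi ∧ -(Real.pi / 2) - N * Real.pi < θ T := by
  have hset : {t ∈ Ioc 0 T | u t = 0} = {t ∈ Ioc 0 T | Real.cos (θ t) = 0} := by
    ext t
    refine and_congr_right fun ht => ?_
    rw [hcos t ⟨ht.1.le, ht.2⟩, mul_eq_zero_iff_left (hr t).ne']
  rw [hset]
  refine exists_ncard_cos_zeros hT hθ hθ0 ?_ ?_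
  · intro s hs hz
    have hmem : Icc 0 T ∈ 𝓝[>] s := Icc_mem_nhdsGT_of_mem hs
    have hs' : s ∈ Icc 0 T := ⟨hs.1, hs.2.le⟩
    filter_upwards [eventually_mul_sub_neg_of_polar hr (lt_irrefl s)
      ((hu s hs').mono_of_mem_nhdsWithin hmem) ((hθ s hs').mono_of_mem_nhdsWithin hmem)
      (by filter_upwards [hmem] with t ht using hcos t ht) (hcos s hs') (hsin s hs') hz,
      self_mem_nhdsWithin] with t ht hts
    have hts : s < t := hts
    nlinarith
  · intro s hs hz
    have hmem : Icc 0 T ∈ 𝓝[<] s := Icc_mem_nhdsLT_of_mem hs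
    have hs' : s ∈ Icc 0 T := ⟨hs.1.le, hs.2⟩
    filter_upwards [eventually_mul_sub_neg_of_polar hr (lt_irrefl s)
      ((hu s hs').mono_of_mem_nhdsWithin hmem) ((hθ s hs').mono_of_mem_nhdsWithin hmem)
      (by filter_upwards [hmem] with t ht using hcos t ht) (hcos s hs') (hsin s hs') hz,
      self_mem_nhdsWithin] with t ht hts
    have hts : t < s := hts
    nlinarith

end Counting

theorem eq_zero_of_cos_eq_one {S : Set ℝ} {g : ℝ → ℝ} (hS : IsPreconnected S)
    (hg : ContinuousOn g S) (hcos : ∀ x ∈ S, Real.cos (g x) = 1) {x₀ x : ℝ} (hx₀ : x₀ ∈ S)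
    (h0 : g x₀ = 0) (hx : x ∈ S) : g x = 0 := by
  have hpi := Real.pi_pos
  have hord := (hS.image g hg).ordConnected
  have hone : ∀ y ∈ g '' S, Real.cos y = 1 := by
    rintro _ ⟨z, hz, rfl⟩
    exact hcos z hz
  have h0m : (0 : ℝ) ∈ g '' S := ⟨x₀, hx₀, h0⟩
  have hxm : g x ∈ g '' S := ⟨x, hx, rfl⟩
  by_contra hne
  rcases lt_or_gt_of_ne hne with hlt | hlt
  · have h1 := hone _ (hord.out hxm h0m
      (⟨le_max_left _ _, max_le hlt.le (by linarith)⟩ : max (g x) (-Real.pi) ∈ Icc (g x) 0))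
    have hneg : max (g x) (-Real.pi) < 0 := max_lt hlt (by linarith)
    have h2 := (Real.cos_eq_one_iff_of_lt_of_lt
      (by linarith [le_max_right (g x) (-Real.pi)]) (by linarith)).1 h1
    linarith
  · have h1 := hone _ (hord.out h0m hxm
      (⟨le_min hlt.le hpi.le, min_le_left _ _⟩ : min (g x) Real.pi ∈ Icc 0 (g x)))
    have hpos : 0 < min (g x) Real.pi := lt_min hlt hpi
    have h2 := (Real.cos_eq_one_iff_of_lt_of_lt (by linarith)
      (by linarith [min_le_right (g x) Real.pi])).1 h1
    linarith

theorem cos_sub_eq_one_of_polar_eq {r ρ φ ψ : ℝ} (hr : 0 < r) (hρ : 0 ≤ ρ)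
    (hcos : r * Real.cos φ = ρ * Real.cos ψ) (hsin : r * Real.sin φ = ρ * Real.sin ψ) :
    Real.cos (φ - ψ) = 1 := by
  have h1 := Real.sin_sq_add_cos_sq φ
  have h2 := Real.sin_sq_add_cos_sq ψ
  have hsq : r ^ 2 = ρ ^ 2 := by
    calc r ^ 2 = (r * Real.cos φ) ^ 2 + (r * Real.sin φ) ^ 2 := by linear_combination -(r ^ 2) * h1
      _ = ρ ^ 2 := by rw [hcos, hsin]; linear_combination (ρ ^ 2) * h2
  have hrρ : r = ρ := (sq_eq_sq₀ hr.le hρ).1 hsq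
  rw [← hrρ] at hcos hsin
  rw [Real.cos_sub, mul_left_cancel₀ hr.ne' hcos, mul_left_cancel₀ hr.ne' hsin]
  linarith

section Family

variable {h : ℝ → ℝ} {lam q T : ℝ} {U U' U'' : ℝ → ℝ → ℝ}

theorem solOn_one (h : ℝ → ℝ) (lam q : ℝ) (S S' : Set ℝ) :
    SolOn h lam q S S' (fun _ => 1) (fun _ => 0) (fun _ => 0) :=
  ⟨fun _ _ => hasDerivWithinAt_const _ _ _, continuousOn_const,
    fun _ _ => hasDerivWithinAt_const _ _ _, continuousOn_const, fun _ _ => by simp⟩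

theorem SolOn.eq_one (hlam : 0 < lam) (hq : 1 < q) (hh : ∀ t ∈ Ioo 0 T, 0 ≤ h t)
    {u u' u'' : ℝ → ℝ} (hs : SolOn h lam q (Icc 0 T) (Ioc 0 T) u u' u'')
    (h1 : u 0 = 1) (h0 : u' 0 = 0) {t : ℝ} (ht : t ∈ Icc 0 T) : u t = 1 ∧ u' t = 0 := by
  obtain ⟨C, hC⟩ := exists_dist_sq_le hlam hq hh 1
  have key := hC _ _ _ _ _ _ hs (solOn_one h lam q _ _) h1.ge h1.le h0 le_rfl le_rfl rfl t ht
  rw [h1] at key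
  constructor <;> nlinarith [sq_nonneg (u t - 1), sq_nonneg (u' t - 0)]

theorem continuousOn_family (hlam : 0 < lam) (hq : 1 < q) (hh : ∀ t ∈ Ioo 0 T, 0 ≤ h t)
    (hU : ∀ s, SolOn h lam q (Icc 0 T) (Ioc 0 T) (U s) (U' s) (U'' s) ∧ U s 0 = s ∧ U' s 0 = 0)
    (A : ℝ) :
    ContinuousOn (fun p : ℝ × ℝ => U p.1 p.2) (Icc 1 A ×ˢ Icc 0 T) ∧
      ContinuousOn (fun p : ℝ × ℝ => U' p.1 p.2) (Icc 1 A ×ˢ Icc 0 T) := by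
  obtain ⟨C, hC⟩ := exists_dist_sq_le hlam hq hh A
  have hdist : ∀ s ∈ Icc 1 A, ∀ r ∈ Icc 1 A, ∀ t ∈ Icc 0 T,
      (U s t - U r t) ^ 2 + (U' s t - U' r t) ^ 2 ≤ (s - r) ^ 2 * C := by
    intro s hs r hr t ht
    have := hC _ _ _ _ _ _ (hU s).1 (hU r).1 (by rw [(hU s).2.1]; exact hs.1)
      (by rw [(hU s).2.1]; exact hs.2) (hU s).2.2 (by rw [(hU r).2.1]; exact hr.1)
      (by rw [(hU r).2.1]; exact hr.2) (hU r).2.2 t ht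
    rwa [(hU s).2.1, (hU r).2.1] at this
  have hsqrt : ∀ x s r : ℝ, x ^ 2 ≤ (s - r) ^ 2 * C → |x| ≤ Real.sqrt C * |s - r| := by
    intro x s r hx
    have h1 := Real.sqrt_le_sqrt hx
    rwa [Real.sqrt_sq_eq_abs, Real.sqrt_mul (sq_nonneg _), Real.sqrt_sq_eq_abs, mul_comm] at h1
  constructor
  · refine continuousOn_prod_of_continuousOn_lipschitzOnWith _ (Real.sqrt C).toNNReal
      (fun s _ => (hU s).1.continuousOn) fun t ht => LipschitzOnWith.of_dist_le_mul ?_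
    intro s hs r hr
    rw [Real.dist_eq, Real.dist_eq, Real.coe_toNNReal _ (Real.sqrt_nonneg C)]
    exact hsqrt _ _ _ (by linarith [hdist s hs r hr t ht, sq_nonneg (U' s t - U' r t)])
  · refine continuousOn_prod_of_continuousOn_lipschitzOnWith _ (Real.sqrt C).toNNReal
      (fun s _ => (hU s).1.2.1) fun t ht => LipschitzOnWith.of_dist_le_mul ?_
    intro s hs r hr
    rw [Real.dist_eq, Real.dist_eq, Real.coe_toNNReal _ (Real.sqrt_nonneg C)]
    exact hsqrt _ _ _ (by linarith [hdist s hs r hr t ht, sq_nonneg (U s t - U r t)])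

theorem exists_polar_family (hT : 0 < T) (hlam : 0 < lam) (hq : 1 < q)
    (hc : ContinuousOn h (Ioc 0 T)) (hh : ∀ t ∈ Ioo 0 T, 0 ≤ h t)
    (hU : ∀ s, SolOn h lam q (Icc 0 T) (Ioc 0 T) (U s) (U' s) (U'' s) ∧ U s 0 = s ∧ U' s 0 = 0)
    {A : ℝ} (hA : 1 ≤ A) :
    ∃ r θ : ℝ × ℝ → ℝ, (∀ p, 0 < r p) ∧ Continuous θ ∧ θ (1, 0) = 0 ∧
      ∀ s ∈ Icc 1 A, ∀ t ∈ Icc 0 T,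
        U s t = r (s, t) * Real.cos (θ (s, t)) ∧ U' s t = r (s, t) * Real.sin (θ (s, t)) := by
  obtain ⟨hc1, hc2⟩ := continuousOn_family hlam hq hh hU A
  let P : ℝ × ℝ → ℝ × ℝ := fun p => (projIcc 1 A hA p.1, projIcc 0 T hT.le p.2)
  have hP : Continuous P :=
    (continuous_subtype_val.comp (continuous_projIcc.comp continuous_fst)).prodMk
      (continuous_subtype_val.comp (continuous_projIcc.comp continuous_snd))
  have hPmem : ∀ p, P p ∈ Icc 1 A ×ˢ Icc 0 T := fun p => ⟨Subtype.prop _, Subtype.prop _⟩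
  have hPeq : ∀ s ∈ Icc 1 A, ∀ t ∈ Icc 0 T, P (s, t) = (s, t) := fun s hs t ht => by
    simp only [P, projIcc_of_mem hA hs, projIcc_of_mem hT.le ht]
  let G : C(ℝ × ℝ, ℂ) :=
    ⟨fun p => (U (P p).1 (P p).2 : ℂ) + (U' (P p).1 (P p).2 : ℂ) * Complex.I,
      (Complex.continuous_ofReal.comp (hc1.comp_continuous hP hPmem)).add
        ((Complex.continuous_ofReal.comp (hc2.comp_continuous hP hPmem)).mul continuous_const)⟩
  have hG : ∀ p, G p = (U (P p).1 (P p).2 : ℂ) + (U' (P p).1 (P p).2 : ℂ) * Complex.I :=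
    fun _ => rfl
  have hG0 : ∀ p, G p ∈ ({0}ᶜ : Set ℂ) := by
    intro p hp
    have hp : G p = 0 := hp
    have hre := congrArg Complex.re hp
    have him := congrArg Complex.im hp
    simp only [hG, Complex.add_re, Complex.add_im, Complex.ofReal_re, Complex.ofReal_im,
      Complex.mul_re, Complex.mul_im, Complex.I_re, Complex.I_im, Complex.zero_re,
      Complex.zero_im, mul_zero, mul_one, sub_zero, zero_add, add_zero] at hre him
    have := (hU (P p).1).1.sq_add_sq_pos hlam hq hc hh
      (by rw [(hU _).2.1]; exact (hPmem p).1.1) (hU _).2.2 (hPmem p).2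
    rw [hre, him] at this
    norm_num at this
  have hstart : Complex.exp 0 = G (1, 0) := by
    rw [hG, hPeq 1 ⟨le_rfl, hA⟩ 0 ⟨le_rfl, hT.le⟩, (hU 1).2.1, (hU 1).2.2]
    simp
  obtain ⟨F, ⟨hF0, hF⟩, -⟩ :=
    Complex.isCoveringMapOn_exp.existsUnique_continuousMap_lifts G hstart hG0
  refine ⟨fun p => Real.exp (F p).re, fun p => (F p).im, fun p => Real.exp_pos _,
    Complex.continuous_im.comp F.continuous, by simp [hF0], fun s hs t ht => ?_⟩
  have hFp : Complex.exp (F (s, t)) = G (s, t) := congrFun hF (s, t)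
  rw [hG, hPeq s hs t ht] at hFp
  have hre := congrArg Complex.re hFp
  have him := congrArg Complex.im hFp
  simp only [Complex.exp_re, Complex.exp_im, Complex.add_re, Complex.add_im, Complex.ofReal_re,
    Complex.ofReal_im, Complex.mul_re, Complex.mul_im, Complex.I_re, Complex.I_im, mul_zero,
    mul_one, sub_zero, zero_add, add_zero] at hre him
  exact ⟨hre.symm, him.symm⟩

theorem exists_ncard_zeros_of_family (hT : 0 < T) (hlam : 0 < lam) (hq : 1 < q)
    (hc : ContinuousOn h (Ioc 0 T)) (hh : ∀ t ∈ Ioo 0 T, 0 ≤ h t)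
    (hU : ∀ s, SolOn h lam q (Icc 0 T) (Ioc 0 T) (U s) (U' s) (U'' s) ∧ U s 0 = s ∧ U' s 0 = 0)
    {a ρ : ℝ → ℝ} (haCont : ContinuousOn a (Ioi 0)) (ha1 : a 1 = 0) (hρ : ∀ s, 0 ≤ ρ s)
    (haAngle : ∀ s, 0 < s → U s T = ρ s * Real.cos (a s) ∧ U' s T = ρ s * Real.sin (a s))
    {α : ℝ} (hα : 1 ≤ α) :
    ∃ N : ℕ, {t ∈ Ioc 0 T | U α t = 0}.Finite ∧ {t ∈ Ioc 0 T | U α t = 0}.ncard = N ∧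
      a α ≤ Real.pi / 2 - N * Real.pi ∧ -(Real.pi / 2) - N * Real.pi < a α := by
  obtain ⟨r, θ, hr, hθ, hθ0, hpol⟩ := exists_polar_family hT hlam hq hc hh hU hα
  have h0 : (0 : ℝ) ∈ Icc 0 T := ⟨le_rfl, hT.le⟩
  have hTm : T ∈ Icc 0 T := ⟨hT.le, le_rfl⟩
  have h1m : (1 : ℝ) ∈ Icc 1 α := ⟨le_rfl, hα⟩
  have hαm : α ∈ Icc 1 α := ⟨hα, le_rfl⟩
  have hleft : ∀ s ∈ Icc 1 α, θ (s, 0) = 0 := fun s hs => by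
    refine eq_zero_of_cos_eq_one (g := fun s => θ (s, 0)) isPreconnected_Icc
      (hθ.comp (by fun_prop)).continuousOn (fun x hx => ?_) h1m hθ0 hs
    obtain ⟨e1, e2⟩ := hpol x hx 0 h0
    rw [(hU x).2.1] at e1
    rw [(hU x).2.2] at e2
    rw [← sub_zero (θ (x, 0))]
    exact cos_sub_eq_one_of_polar_eq (hr (x, 0)) (ρ := x) (by linarith [hx.1]) (by simp [← e1])
      (by simp [← e2])
  have hbottom : θ (1, T) = 0 := by
    refine eq_zero_of_cos_eq_one (g := fun t => θ (1, t)) isPreconnected_Icc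
      (hθ.comp (by fun_prop)).continuousOn (fun x hx => ?_) h0 hθ0 hTm
    obtain ⟨e1, e2⟩ := hpol 1 h1m x hx
    obtain ⟨e3, e4⟩ := (hU 1).1.eq_one hlam hq hh (hU 1).2.1 (hU 1).2.2 hx
    rw [e3] at e1
    rw [e4] at e2
    rw [← sub_zero (θ (1, x))]
    exact cos_sub_eq_one_of_polar_eq (hr (1, x)) (ρ := 1) zero_le_one (by simp [← e1])
      (by simp [← e2])
  have hright : θ (α, T) - a α = 0 := by
    refine eq_zero_of_cos_eq_one (g := fun s => θ (s, T) - a s) isPreconnected_Icc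
      ((hθ.comp (by fun_prop)).continuousOn.sub
        (haCont.mono fun x hx => zero_lt_one.trans_le hx.1)) (fun x hx => ?_) h1m
      (by simp [hbottom, ha1]) hαm
    obtain ⟨e1, e2⟩ := hpol x hx T hTm
    obtain ⟨e3, e4⟩ := haAngle x (zero_lt_one.trans_le hx.1)
    exact cos_sub_eq_one_of_polar_eq (hr (x, T)) (hρ x) (e1.symm.trans e3) (e2.symm.trans e4)
  rw [← sub_eq_zero.1 hright]
  exact exists_ncard_zeros_of_polar (θ := fun t => θ (α, t)) (u' := U' α)
    (r := fun t => r (α, t)) hT (fun t => hr _) (hU α).1.1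
    (hθ.comp (by fun_prop)).continuousOn (hleft α hαm) (fun t ht => (hpol α hαm t ht).1)
    (fun t ht => (hpol α hαm t ht).2)

end Family

theorem SolOn.reflect {h : ℝ → ℝ} {lam q t₀ d : ℝ} {v v' v'' : ℝ → ℝ}
    (hs : SolOn h lam q (Icc t₀ d) (Ico t₀ d) v v' v'') :
    SolOn (fun t => -h (d - t)) lam q (Icc 0 (d - t₀)) (Ioc 0 (d - t₀))
      (fun t => v (d - t)) (fun t => -v' (d - t)) (fun t => v'' (d - t)) := by
  have hm1 : MapsTo (fun t => d - t) (Icc 0 (d - t₀)) (Icc t₀ d) := fun t ht =>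
    ⟨by linarith [ht.2], by linarith [ht.1]⟩
  have hm2 : MapsTo (fun t => d - t) (Ioc 0 (d - t₀)) (Ico t₀ d) := fun t ht =>
    ⟨by linarith [ht.2], by linarith [ht.1]⟩
  have hd : ∀ (S : Set ℝ) (t : ℝ), HasDerivWithinAt (fun t => d - t) (-1) S t := fun S t =>
    (hasDerivWithinAt_id t S).const_sub d
  refine ⟨fun t ht => ?_, (hs.2.1.comp (by fun_prop) hm1).neg, fun t ht => ?_,
    hs.2.2.2.1.comp (by fun_prop) hm2, fun t ht => ?_⟩
  · exact ((hs.1 _ (hm1 ht)).scomp t (hd _ t) hm1).congr_deriv (by simp)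
  · exact ((hs.2.2.1 _ (hm2 ht)).scomp t (hd _ t) hm2).neg.congr_deriv (by simp)
  · linarith [hs.2.2.2.2 _ (hm2 ht)]

theorem SolOn.neg {h : ℝ → ℝ} {lam q : ℝ} {S S' : Set ℝ} {v v' v'' : ℝ → ℝ}
    (hs : SolOn h lam q S S' v v' v'') :
    SolOn h lam q S S' (fun t => -v t) (fun t => -v' t) (fun t => -v'' t) :=
  ⟨fun t ht => (hs.1 t ht).neg, hs.2.1.neg, fun t ht => (hs.2.2.1 t ht).neg, hs.2.2.2.1.neg,
    fun t ht => by rw [abs_neg]; linarith [hs.2.2.2.2 t ht]⟩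

section Gluing

variable {f g f' g' : ℝ → ℝ} {c : ℝ} {S₁ S₂ : Set ℝ}

theorem mem_left_of_le (h2 : S₂ ⊆ Ici c) (hc1 : c ∈ S₁) {t : ℝ} (ht : t ∈ S₁ ∪ S₂) (hle : t ≤ c) :
    t ∈ S₁ := by
  rcases ht with ht | ht
  · exact ht
  · rwa [le_antisymm hle (h2 ht)]

theorem mem_right_of_le (h1 : S₁ ⊆ Iic c) (hc2 : c ∈ S₂) {t : ℝ} (ht : t ∈ S₁ ∪ S₂)
    (hle : c ≤ t) : t ∈ S₂ := by
  rcases ht with ht | ht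
  · rwa [le_antisymm (h1 ht) hle]
  · exact ht

theorem ite_le_eq_right (hfg : f c = g c) {t : ℝ} (ht : c ≤ t) :
    (if t ≤ c then f t else g t) = g t := by
  split_ifs with hle
  · rw [le_antisymm hle ht, hfg]
  · rfl

theorem hasDerivWithinAt_ite_le (h1 : S₁ ⊆ Iic c) (h2 : S₂ ⊆ Ici c) (hc1 : c ∈ S₁) (hc2 : c ∈ S₂)
    (hfg : f c = g c) (hfg' : f' c = g' c) (hf : ∀ t ∈ S₁, HasDerivWithinAt f (f' t) S₁ t)
    (hg : ∀ t ∈ S₂, HasDerivWithinAt g (g' t) S₂ t) {t : ℝ} (ht : t ∈ S₁ ∪ S₂) :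
    HasDerivWithinAt (fun t => if t ≤ c then f t else g t) (if t ≤ c then f' t else g' t)
      (S₁ ∪ S₂) t := by
  refine HasDerivWithinAt.union ?_ ?_
  · rcases le_or_gt t c with hle | hlt
    · rw [if_pos hle]
      exact (hf t (mem_left_of_le h2 hc1 ht hle)).congr (fun x hx => if_pos (h1 hx)) (if_pos hle)
    · exact HasFDerivWithinAt.of_notMem_closure fun hmem =>
        hlt.not_ge (closure_minimal h1 isClosed_Iic hmem)
  · rcases le_or_gt c t with hle | hlt
    · rw [ite_le_eq_right hfg' hle]
      exact (hg t (mem_right_of_le h1 hc2 ht hle)).congr (fun x hx => ite_le_eq_right hfg (h2 hx))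
        (ite_le_eq_right hfg hle)
    · exact HasFDerivWithinAt.of_notMem_closure fun hmem =>
        hlt.not_ge (closure_minimal h2 isClosed_Ici hmem)

theorem continuousOn_ite_le (h1 : S₁ ⊆ Iic c) (h2 : S₂ ⊆ Ici c) (hc1 : c ∈ S₁) (hc2 : c ∈ S₂)
    (hfg : f c = g c) (hf : ContinuousOn f S₁) (hg : ContinuousOn g S₂) :
    ContinuousOn (fun t => if t ≤ c then f t else g t) (S₁ ∪ S₂) := by
  intro t ht
  refine ContinuousWithinAt.union ?_ ?_
  · rcases le_or_gt t c with hle | hlt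
    · exact (hf t (mem_left_of_le h2 hc1 ht hle)).congr (fun x hx => if_pos (h1 hx)) (if_pos hle)
    · exact continuousWithinAt_of_notMem_closure fun hmem =>
        hlt.not_ge (closure_minimal h1 isClosed_Iic hmem)
  · rcases le_or_gt c t with hle | hlt
    · exact (hg t (mem_right_of_le h1 hc2 ht hle)).congr (fun x hx => ite_le_eq_right hfg (h2 hx))
        (ite_le_eq_right hfg hle)
    · exact continuousWithinAt_of_notMem_closure fun hmem =>
        hlt.not_ge (closure_minimal h2 isClosed_Ici hmem)

theorem SolOn.glue {h : ℝ → ℝ} {lam q d : ℝ} (hc : c ∈ Ioo 0 d) {u u' u'' v v' v'' : ℝ → ℝ}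
    (hu : SolOn h lam q (Icc 0 c) (Ioc 0 c) u u' u'')
    (hv : SolOn h lam q (Icc c d) (Ico c d) v v' v'') (h0 : u c = v c) (h1 : u' c = v' c) :
    SolOn h lam q (Icc 0 d) (Ioo 0 d) (fun t => if t ≤ c then u t else v t)
      (fun t => if t ≤ c then u' t else v' t) (fun t => if t ≤ c then u'' t else v'' t) := by
  have hl : c ∈ Icc 0 c := right_mem_Icc.2 hc.1.le
  have hr : c ∈ Icc c d := left_mem_Icc.2 hc.2.le
  have hl' : c ∈ Ioc 0 c := ⟨hc.1, le_rfl⟩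
  have hr' : c ∈ Ico c d := ⟨le_rfl, hc.2⟩
  have h2 : u'' c = v'' c := by
    have e1 := hu.2.2.2.2 c hl'
    have e2 := hv.2.2.2.2 c hr'
    rw [h0, h1] at e1
    linarith
  have s1 : Icc 0 c ⊆ Iic c := fun x hx => hx.2
  have s2 : Icc c d ⊆ Ici c := fun x hx => hx.1
  have s3 : Ioc 0 c ⊆ Iic c := fun x hx => hx.2
  have s4 : Ico c d ⊆ Ici c := fun x hx => hx.1
  rw [← Icc_union_Icc_eq_Icc hc.1.le hc.2.le, ← Ioc_union_Ico_eq_Ioo hc.1 hc.2]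
  refine ⟨fun t ht => hasDerivWithinAt_ite_le s1 s2 hl hr h0 h1 hu.1 hv.1 ht,
    continuousOn_ite_le s1 s2 hl hr h1 hu.2.1 hv.2.1,
    fun t ht => hasDerivWithinAt_ite_le s3 s4 hl' hr' h1 h2 hu.2.2.1 hv.2.2.1 ht,
    continuousOn_ite_le s3 s4 hl' hr' h2 hu.2.2.2.1 hv.2.2.2.1, fun t ht => ?_⟩
  rcases le_or_gt t c with hle | hlt
  · simp only [if_pos hle]
    exact hu.2.2.2.2 t (mem_left_of_le s4 hl' ht hle)
  · simp only [if_neg hlt.not_ge]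
    exact hv.2.2.2.2 t (mem_right_of_le s3 hr' ht hlt.le)

end Gluing

theorem enorm2_nonneg (p : ℝ × ℝ) : 0 ≤ enorm2 p := Real.sqrt_nonneg _

theorem enorm2_neg_right (x y : ℝ) : enorm2 (x, -y) = enorm2 (x, y) := by
  simp [enorm2]

theorem enorm2_pos {x y : ℝ} (hxy : 0 < x ^ 2 + y ^ 2) : 0 < enorm2 (x, y) :=
  Real.sqrt_pos.2 hxy

theorem cos_sub_odd_mul_pi (x : ℝ) (k : ℕ) :
    Real.cos (x - (2 * (k : ℝ) - 1) * Real.pi) = -Real.cos x := by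
  rw [show x - (2 * (k : ℝ) - 1) * Real.pi = x + Real.pi - k * (2 * Real.pi) by ring,
    Real.cos_sub_nat_mul_two_pi, Real.cos_add_pi]

theorem sin_sub_odd_mul_pi (x : ℝ) (k : ℕ) :
    Real.sin (x - (2 * (k : ℝ) - 1) * Real.pi) = -Real.sin x := by
  rw [show x - (2 * (k : ℝ) - 1) * Real.pi = x + Real.pi - k * (2 * Real.pi) by ring,
    Real.sin_sub_nat_mul_two_pi, Real.sin_add_pi]

theorem add_eq_of_angle_bounds {x y : ℝ} {k N M : ℕ}
    (hxy : x = y - (2 * (k : ℝ) - 1) * Real.pi)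
    (hx1 : x ≤ Real.pi / 2 - N * Real.pi) (hx2 : -(Real.pi / 2) - N * Real.pi < x)
    (hy1 : -y ≤ Real.pi / 2 - M * Real.pi) (hy2 : -(Real.pi / 2) - M * Real.pi < -y) :
    N + M + 1 = 2 * k + (if Real.cos x = 0 then 1 else 0) := by
  have hpi := Real.pi_pos
  have h1 : N + M ≤ 2 * k := by
    have : ((N : ℝ) + M) * Real.pi ≤ (2 * k) * Real.pi := by linarith
    exact_mod_cast le_of_mul_le_mul_right this hpi
  have h2 : 2 * k < N + M + 2 := by
    have : (2 * k : ℝ) * Real.pi < (N + M + 2) * Real.pi := by linarith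
    exact_mod_cast lt_of_mul_lt_mul_right this hpi.le
  split_ifs with hcos
  · by_contra hne
    have hk : N + M + 1 = 2 * k := by omega
    have hkR : (N : ℝ) + M + 1 = 2 * k := by exact_mod_cast hk
    obtain ⟨m, hm⟩ := Real.cos_eq_zero_iff.1 hcos
    have hm1 : m = -N := by
      have e1 : ((m : ℝ) + N) * Real.pi ≤ 0 := by linarith
      have e2 : 0 < ((m : ℝ) + N + 1) * Real.pi := by linarith
      have e3 : (m : ℝ) + N ≤ 0 := nonpos_of_mul_nonpos_left e1 hpi
      have e4 : 0 < (m : ℝ) + N + 1 := pos_of_mul_pos_left e2 hpi.le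
      have e5 : m + N ≤ 0 := by exact_mod_cast e3
      have e6 : 0 < m + N + 1 := by exact_mod_cast e4
      omega
    rw [hm1] at hm
    push_cast at hm
    rw [← hkR] at hxy
    linarith
  · by_contra hne
    have hk : N + M = 2 * k := by omega
    have hkR : (N : ℝ) + M = 2 * k := by exact_mod_cast hk
    rw [← hkR] at hxy
    have hx : x = (2 * ((-N : ℤ) : ℝ) + 1) * Real.pi / 2 := by push_cast; linarith
    exact hcos (Real.cos_eq_zero_iff.2 ⟨_, hx⟩)

theorem stmt_15
    (d lam : ℝ) (hd : 0 < d) (hlam : 0 < lam)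
    (n m₁ m₂ : ℤ) (hn : 3 ≤ n)
    (hm₁0 : 0 ≤ m₁) (hm₁n : m₁ ≤ n - 2) (hm₂0 : 0 ≤ m₂) (hm₂n : m₂ ≤ n - 2)
    (h : ℝ → ℝ) (hC1 : ContDiffOn ℝ 1 h (Set.Ioo 0 d))
    (hder : ∀ t ∈ Set.Ioo 0 d, deriv h t < 0)
    (hlim0 : Filter.Tendsto (fun t => t * h t) (nhdsWithin 0 (Set.Ioi 0))
      (nhds ((n : ℝ) - (m₁ : ℝ) - 1)))
    (hlimd : Filter.Tendsto (fun t => (t - d) * h t) (nhdsWithin d (Set.Iio d))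
      (nhds ((n : ℝ) - (m₂ : ℝ) - 1)))
    (q : ℝ) (hq1 : 1 < q)
    (t₀ : ℝ) (ht₀ : t₀ ∈ Set.Ioo 0 d)
    (hpos : ∀ t ∈ Set.Ioo 0 t₀, 0 < h t) (hneg : ∀ t ∈ Set.Ioo t₀ d, h t < 0)
    (U U' U'' : ℝ → ℝ → ℝ)
    (hU : ∀ α : ℝ, SolOn h lam q (Set.Icc 0 t₀) (Set.Ioc 0 t₀) (U α) (U' α) (U'' α) ∧
      U α 0 = α ∧ U' α 0 = 0)
    (hUuniq : ∀ α : ℝ, ∀ u u' u'' : ℝ → ℝ,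
      SolOn h lam q (Set.Icc 0 t₀) (Set.Ioc 0 t₀) u u' u'' → u 0 = α → u' 0 = 0 →
      ∀ t ∈ Set.Icc 0 t₀, u t = U α t ∧ u' t = U' α t)
    (V V' V'' : ℝ → ℝ → ℝ)
    (hV : ∀ β : ℝ, SolOn h lam q (Set.Icc t₀ d) (Set.Ico t₀ d) (V β) (V' β) (V'' β) ∧
      V β d = β ∧ V' β d = 0)
    (hVuniq : ∀ β : ℝ, ∀ u u' u'' : ℝ → ℝ,
      SolOn h lam q (Set.Icc t₀ d) (Set.Ico t₀ d) u u' u'' → u d = β → u' d = 0 →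
      ∀ t ∈ Set.Icc t₀ d, u t = V β t ∧ u' t = V' β t)
    (a : ℝ → ℝ) (haCont : ContinuousOn a (Set.Ioi 0)) (ha1 : a 1 = 0)
    (haAngle : ∀ α : ℝ, 0 < α →
      U α t₀ = enorm2 (U α t₀, U' α t₀) * Real.cos (a α) ∧
      U' α t₀ = enorm2 (U α t₀, U' α t₀) * Real.sin (a α))
    (b : ℝ → ℝ) (hbCont : ContinuousOn b (Set.Ioi 0)) (hb1 : b 1 = 0)
    (hbAngle : ∀ β : ℝ, 0 < β →
      V β t₀ = enorm2 (V β t₀, V' β t₀) * Real.cos (b β) ∧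
      V' β t₀ = enorm2 (V β t₀, V' β t₀) * Real.sin (b β))
    (k : ℕ) (hk : 0 < k)
    (α β : ℝ) (hα : 1 < α) (hβ : 1 < β)
    (hab : a α = b β - (2 * (k : ℝ) - 1) * Real.pi)
    (hnorm : enorm2 (U α t₀, U' α t₀) = enorm2 (V β t₀, V' β t₀)) :
    (U α t₀, U' α t₀) = (V (-β) t₀, V' (-β) t₀) ∧
    (V (-β) t₀, V' (-β) t₀) = (-(V β t₀), -(V' β t₀)) ∧
    SolOn h lam q (Set.Icc 0 d) (Set.Ioo 0 d)
      (fun t => if t ≤ t₀ then U α t else V (-β) t)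
      (fun t => if t ≤ t₀ then U' α t else V' (-β) t)
      (fun t => if t ≤ t₀ then U'' α t else V'' (-β) t) ∧
    (if (0 : ℝ) ≤ t₀ then U' α 0 else V' (-β) 0) = 0 ∧
    (if d ≤ t₀ then U' α d else V' (-β) d) = 0 ∧
    {t ∈ Set.Ioo 0 d | (if t ≤ t₀ then U α t else V (-β) t) = 0}.Finite ∧
    {t ∈ Set.Ioo 0 d | (if t ≤ t₀ then U α t else V (-β) t) = 0}.ncard = 2 * k - 1 := by
  have hcont := hC1.continuousOn
  have hT₂ : 0 < d - t₀ := by linarith [ht₀.2]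
  have hβ0 : 0 < β := by linarith
  have hα0 : 0 < α := by linarith
  have hVneg : ∀ t ∈ Icc t₀ d, V (-β) t = -V β t ∧ V' (-β) t = -V' β t := fun t ht => by
    obtain ⟨e1, e2⟩ := hVuniq (-β) _ _ _ (hV β).1.neg (by simp [(hV β).2.1])
      (by simp [(hV β).2.2]) t ht
    exact ⟨e1.symm, e2.symm⟩
  obtain ⟨hV0, hV0'⟩ := hVneg t₀ ⟨le_rfl, ht₀.2.le⟩
  obtain ⟨haU, haU'⟩ := haAngle α hα0
  obtain ⟨hbV, hbV'⟩ := hbAngle β hβ0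
  have hUV : U α t₀ = V (-β) t₀ := by
    rw [haU, hab, cos_sub_odd_mul_pi, hnorm, hV0, mul_neg, ← hbV]
  have hUV' : U' α t₀ = V' (-β) t₀ := by
    rw [haU', hab, sin_sub_odd_mul_pi, hnorm, hV0', mul_neg, ← hbV']
  have hh₁ : ∀ t ∈ Ioo 0 t₀, 0 ≤ h t := fun t ht => (hpos t ht).le
  have hc₁ : ContinuousOn h (Ioc 0 t₀) := hcont.mono fun t ht => ⟨ht.1, ht.2.trans_lt ht₀.2⟩
  obtain ⟨N, hNfin, hNcard, hN1, hN2⟩ := exists_ncard_zeros_of_family ht₀.1 hlam hq1 hc₁ hh₁ hU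
    haCont ha1 (fun s => enorm2_nonneg (U s t₀, U' s t₀)) haAngle hα.le
  obtain ⟨M, hMfin, hMcard, hM1, hM2⟩ := exists_ncard_zeros_of_family
    (h := fun t => -h (d - t)) (U := fun s t => V s (d - t)) (U' := fun s t => -V' s (d - t))
    (U'' := fun s t => V'' s (d - t)) (a := fun s => -b s)
    (ρ := fun s => enorm2 (V s t₀, V' s t₀)) hT₂ hlam hq1
    (hcont.comp (by fun_prop)
      fun t ht => ⟨by linarith [ht.2, ht₀.1], by linarith [ht.1]⟩).neg
    (fun t ht => by
      have := hneg (d - t) ⟨by linarith [ht.2], by linarith [ht.1]⟩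
      linarith)
    (fun s => ⟨(hV s).1.reflect, by simp [(hV s).2.1], by simp [(hV s).2.2]⟩)
    hbCont.neg (by simp [hb1]) (fun s => enorm2_nonneg _)
    (fun s hs => by
      obtain ⟨e1, e2⟩ := hbAngle s hs
      rw [sub_sub_cancel, Real.cos_neg, Real.sin_neg, mul_neg, ← e1, ← e2]
      exact ⟨rfl, rfl⟩) hβ.le
  have hsum := add_eq_of_angle_bounds hab hN1 hN2 hM1 hM2
  have hcos : Real.cos (a α) = 0 ↔ U α t₀ = 0 := by
    have hpos := enorm2_pos ((hU α).1.sq_add_sq_pos hlam hq1 hc₁ hh₁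
      (by rw [(hU α).2.1]; exact hα.le) (hU α).2.2 (right_mem_Icc.2 ht₀.1.le))
    conv_rhs => rw [haU]
    rw [mul_eq_zero_iff_left hpos.ne']
  set Z₁ := {t ∈ Ioc 0 t₀ | U α t = 0} with hZ₁
  set Z₂ := {t ∈ Ico t₀ d | V β t = 0} with hZ₂
  have himage : Z₂ = (fun t => d - t) '' {t ∈ Ioc 0 (d - t₀) | V β (d - t) = 0} := by
    ext t
    constructor
    · rintro ⟨ht, hz⟩
      exact ⟨d - t, ⟨⟨by linarith [ht.2], by linarith [ht.1]⟩, by rwa [sub_sub_cancel]⟩,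
        sub_sub_cancel d t⟩
    · rintro ⟨s, ⟨hs, hz⟩, rfl⟩
      exact ⟨⟨by linarith [hs.2], by linarith [hs.1]⟩, hz⟩
  have hZ₂fin : Z₂.Finite := by rw [himage]; exact hMfin.image _
  have hZ₂card : Z₂.ncard = M := by
    rw [himage, (sub_right_injective (b := d)).injOn.ncard_image]
    exact hMcard
  have hunion : {t ∈ Ioo 0 d | (if t ≤ t₀ then U α t else V (-β) t) = 0} = Z₁ ∪ Z₂ := by
    have hright : ∀ t ∈ Icc t₀ d, ((if t ≤ t₀ then U α t else V (-β) t) = 0 ↔ V β t = 0) :=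
      fun t ht => by rw [ite_le_eq_right hUV ht.1, (hVneg t ht).1, neg_eq_zero]
    ext t
    constructor
    · rintro ⟨ht, hz⟩
      rcases le_or_gt t t₀ with hle | hlt
      · exact Or.inl ⟨⟨ht.1, hle⟩, by rwa [if_pos hle] at hz⟩
      · exact Or.inr ⟨⟨hlt.le, ht.2⟩, (hright t ⟨hlt.le, ht.2.le⟩).1 hz⟩
    · rintro (⟨ht, hz⟩ | ⟨ht, hz⟩)
      · exact ⟨⟨ht.1, ht.2.trans_lt ht₀.2⟩, by rwa [if_pos ht.2]⟩
      · exact ⟨⟨ht₀.1.trans_le ht.1, ht.2⟩, (hright t ⟨ht.1, ht.2.le⟩).2 hz⟩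
  have hinter : (Z₁ ∩ Z₂).ncard = if Real.cos (a α) = 0 then 1 else 0 := by
    split_ifs with hz
    · rw [ncard_eq_one]
      refine ⟨t₀, Subset.antisymm (fun t ht => le_antisymm ht.1.1.2 ht.2.1.1) ?_⟩
      rintro _ rfl
      have hz₀ := hcos.1 hz
      exact ⟨⟨⟨ht₀.1, le_rfl⟩, hz₀⟩, ⟨⟨le_rfl, ht₀.2⟩, by
        rwa [hUV, hV0, neg_eq_zero] at hz₀⟩⟩
    · rw [show Z₁ ∩ Z₂ = ∅ from ?_, ncard_empty]
      refine eq_empty_of_forall_notMem fun t ht => hz (hcos.2 ?_)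
      rw [← le_antisymm ht.1.1.2 ht.2.1.1]
      exact ht.1.2
  refine ⟨Prod.ext hUV hUV', Prod.ext hV0 hV0', (hU α).1.glue ht₀ (hV (-β)).1 hUV hUV', ?_, ?_,
    ?_, ?_⟩
  · rw [if_pos ht₀.1.le, (hU α).2.2]
  · rw [if_neg ht₀.2.not_ge, (hV (-β)).2.2]
  · rw [hunion]
    exact hNfin.union hZ₂fin
  · rw [hunion]
    have hadd := ncard_union_add_ncard_inter Z₁ Z₂ hNfin hZ₂fin
    rw [hinter, hNcard, hZ₂card] at hadd
    omega
end

section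
/- For every α > 0 and every nonnegative integer j, if −(2j+1)π/2 < a(α) < −(2j−1)π/2, then the solution u_α has exactly j zeros in the open interval (0,t₀), and u_α(t₀) ≠ 0 with sign(u_α(t₀)) = (−1)^j. -/
open Set Filter

namespace SolOn

lemma exists_lipschitz_nonlinearity {q : ℝ} (hq : 1 < q) {R : ℝ} :
    ∃ L, 0 ≤ L ∧ ∀ x y : ℝ, |x| ≤ R → |y| ≤ R →
      |(|x| ^ (q - 1) * x - x) - (|y| ^ (q - 1) * y - y)| ≤ L * |x - y| := by
  have split (x : ℝ) : |x| ^ (q - 1) * x = max x 0 ^ q - max (-x) 0 ^ q := by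
    have key (y : ℝ) (hy : 0 ≤ y) : y ^ (q - 1) * y = y ^ q := by
      rcases hy.eq_or_lt with rfl | hy
      · simp [Real.zero_rpow (show q ≠ 0 by linarith)]
      · rw [← Real.rpow_add_one hy.ne']; simp
    rcases le_total 0 x with hx | hx
    · rw [abs_of_nonneg hx, max_eq_left hx, max_eq_right (by linarith), key x hx,
        Real.zero_rpow (by linarith), sub_zero]
    · rw [abs_of_nonpos hx, max_eq_right hx, max_eq_left (by linarith), ← key (-x) (by linarith),
        Real.zero_rpow (by linarith)]
      ring
  have lip (x y : ℝ) (hx : x ∈ Icc 0 R) (hy : y ∈ Icc 0 R) :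
      |x ^ q - y ^ q| ≤ (q * R ^ (q - 1)) * |x - y| := by
    have := Convex.norm_image_sub_le_of_norm_hasDerivWithin_le (f := fun x : ℝ => x ^ q)
      (f' := fun x => q * x ^ (q - 1)) (C := q * R ^ (q - 1)) (s := Icc 0 R)
      (fun z _ => (Real.hasDerivAt_rpow_const (Or.inr hq.le)).hasDerivWithinAt)
      (fun z hz => by
        rw [Real.norm_eq_abs, abs_of_nonneg (mul_nonneg (by linarith) (Real.rpow_nonneg hz.1 _))]
        exact mul_le_mul_of_nonneg_left
          (Real.rpow_le_rpow hz.1 hz.2 (by linarith)) (by linarith))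
      (convex_Icc 0 R) hy hx
    simpa [Real.norm_eq_abs] using this
  by_cases hR : R < 0
  · exact ⟨0, le_rfl, fun x y hx _ => absurd (abs_nonneg x) (by linarith)⟩
  push Not at hR
  have hc : 0 ≤ q * R ^ (q - 1) := mul_nonneg (by linarith) (Real.rpow_nonneg hR _)
  refine ⟨2 * (q * R ^ (q - 1)) + 1, by linarith, fun x y hx hy => ?_⟩
  have hmem (z : ℝ) (hz : |z| ≤ R) : max z 0 ∈ Icc 0 R :=
    ⟨le_max_right _ _, max_le ((le_abs_self z).trans hz) hR⟩
  have h1 := lip _ _ (hmem x hx) (hmem y hy)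
  have h2 := lip _ _ (hmem (-x) (by simpa using hx)) (hmem (-y) (by simpa using hy))
  have h3 : |max x 0 - max y 0| ≤ |x - y| := abs_max_sub_max_le_abs x y 0
  have h4 : |max (-x) 0 - max (-y) 0| ≤ |x - y| := by
    have := abs_max_sub_max_le_abs (-x) (-y) 0
    rwa [show -x - -y = -(x - y) by ring, abs_neg] at this
  rw [split, split]
  have e : (max x 0 ^ q - max (-x) 0 ^ q - x) - (max y 0 ^ q - max (-y) 0 ^ q - y)
      = (max x 0 ^ q - max y 0 ^ q) + -(max (-x) 0 ^ q - max (-y) 0 ^ q) + -(x - y) := by ring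
  rw [e]
  refine (abs_add_three _ _ _).trans ?_
  rw [abs_neg, abs_neg]
  nlinarith [mul_le_mul_of_nonneg_left h3 hc, mul_le_mul_of_nonneg_left h4 hc]

lemma exists_bound_of_potential_le {q : ℝ} (hq : 1 < q) (M : ℝ) :
    ∃ R, ∀ x : ℝ, |x| ^ (q + 1) / (q + 1) - x ^ 2 / 2 ≤ M → |x| ≤ R := by
  have ht := tendsto_rpow_atTop (show 0 < q - 1 by linarith)
  obtain ⟨B, hB⟩ := (eventually_atTop.1 (ht.eventually_ge_atTop (q + 1)))
  refine ⟨max (max B 1) (2 * |M|), fun x hx => ?_⟩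
  by_contra! hlt
  obtain ⟨⟨h1, h2⟩, h3⟩ : (B < |x| ∧ 1 < |x|) ∧ 2 * |M| < |x| := by simpa using hlt
  have h4 := hB |x| h1.le
  have h5 : |x| ^ (q + 1) = |x| ^ (q - 1) * x ^ 2 := by
    rw [← sq_abs x, ← Real.rpow_natCast, ← Real.rpow_add (by linarith)]
    congr 1; push_cast; ring
  have h6 : x ^ 2 ≤ |x| ^ (q + 1) / (q + 1) := by
    rw [h5, le_div_iff₀ (by linarith)]
    nlinarith [sq_nonneg x]
  have h7 : |x| ≤ x ^ 2 := by rw [← sq_abs]; nlinarith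
  linarith [le_abs_self M]

lemma hasDerivAt_of_mem {h : ℝ → ℝ} {lam q T : ℝ} {u u' u'' : ℝ → ℝ}
    (hs : SolOn h lam q (Icc 0 T) (Ioc 0 T) u u' u'') {t : ℝ} (ht : t ∈ Ioo 0 T) :
    HasDerivAt u (u' t) t ∧ HasDerivAt u' (u'' t) t ∧
      u'' t = -(h t * u' t) - lam * (|u t| ^ (q - 1) * u t - u t) :=
  ⟨(hs.1 t (Ioo_subset_Icc_self ht)).hasDerivAt (Icc_mem_nhds ht.1 ht.2),
    (hs.2.2.1 t (Ioo_subset_Ioc_self ht)).hasDerivAt (Ioc_mem_nhds ht.1 ht.2),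
    by linarith [hs.2.2.2.2 t (Ioo_subset_Ioc_self ht)]⟩

lemma continuousOn_fst {h : ℝ → ℝ} {lam q : ℝ} {S Sint : Set ℝ} {u u' u'' : ℝ → ℝ}
    (hs : SolOn h lam q S Sint u u' u'') : ContinuousOn u S :=
  fun t ht => (hs.1 t ht).continuousWithinAt

/-- The energy of a solution starting at rest does not exceed its initial value. -/
lemma potential_le {h : ℝ → ℝ} {lam q T : ℝ} (hlam : 0 < lam) (hq : 1 < q)
    (hh : ∀ t ∈ Ioo 0 T, 0 ≤ h t) {u u' u'' : ℝ → ℝ}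
    (hs : SolOn h lam q (Icc 0 T) (Ioc 0 T) u u' u'') (h0 : u' 0 = 0) {t : ℝ}
    (ht : t ∈ Icc 0 T) :
    |u t| ^ (q + 1) / (q + 1) - u t ^ 2 / 2 ≤ |u 0| ^ (q + 1) / (q + 1) - u 0 ^ 2 / 2 := by
  have hder (x : ℝ) (hx : x ∈ Ioo 0 T) : HasDerivAt
      (fun t => u' t ^ 2 / 2 + lam * (|u t| ^ (q + 1) / (q + 1) - u t ^ 2 / 2))
      (-(h x * u' x ^ 2)) x := by
    obtain ⟨h1, h2, h3⟩ := hasDerivAt_of_mem hs hx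
    have h4 := (hasDerivAt_abs_rpow (u x) (show 1 < q + 1 by linarith)).comp x h1
    have h5 := ((h2.pow 2).div_const 2).add
      (((h4.div_const (q + 1)).sub ((h1.pow 2).div_const 2)).const_mul lam)
    refine h5.congr_deriv ?_
    rw [h3, show q + 1 - 2 = q - 1 by ring]
    have : q + 1 ≠ 0 := by linarith
    field_simp
    push_cast
    ring
  have hanti : AntitoneOn
      (fun t => u' t ^ 2 / 2 + lam * (|u t| ^ (q + 1) / (q + 1) - u t ^ 2 / 2)) (Icc 0 T) := by
    refine antitoneOn_of_deriv_nonpos (convex_Icc 0 T) ?_ ?_ ?_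
    · have c1 := continuousOn_fst hs
      have c2 := hs.2.1
      have c3 : ContinuousOn (fun t => |u t| ^ (q + 1)) (Icc 0 T) :=
        c1.abs.rpow_const fun _ _ => Or.inr (by linarith)
      fun_prop
    · rw [interior_Icc]
      exact fun x hx => (hder x hx).differentiableAt.differentiableWithinAt
    · rw [interior_Icc]
      intro x hx
      rw [(hder x hx).deriv]
      nlinarith [mul_nonneg (hh x hx) (sq_nonneg (u' x))]
  have hfin := hanti (left_mem_Icc.2 (ht.1.trans ht.2)) ht ht.1
  simp only [h0] at hfin
  have : lam * (|u t| ^ (q + 1) / (q + 1) - u t ^ 2 / 2)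
      ≤ lam * (|u 0| ^ (q + 1) / (q + 1) - u 0 ^ 2 / 2) := by nlinarith [sq_nonneg (u' t)]
  exact le_of_mul_le_mul_left this hlam

/-- Since the damping coefficient is nonnegative, the singularity at `0` does not affect the
Gronwall estimate for the difference of two solutions. -/
lemma sq_sub_add_sq_sub_le {h : ℝ → ℝ} {lam q T L R : ℝ} (hlam : 0 < lam)
    (hh : ∀ t ∈ Ioo 0 T, 0 ≤ h t) (hL0 : 0 ≤ L)
    (hL : ∀ x y : ℝ, |x| ≤ R → |y| ≤ R →
      |(|x| ^ (q - 1) * x - x) - (|y| ^ (q - 1) * y - y)| ≤ L * |x - y|)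
    {u u' u'' v v' v'' : ℝ → ℝ}
    (hu : SolOn h lam q (Icc 0 T) (Ioc 0 T) u u' u'')
    (hv : SolOn h lam q (Icc 0 T) (Ioc 0 T) v v' v'')
    (hu0 : u' 0 = 0) (hv0 : v' 0 = 0) (huR : ∀ t ∈ Icc 0 T, |u t| ≤ R)
    (hvR : ∀ t ∈ Icc 0 T, |v t| ≤ R) {t : ℝ} (ht : t ∈ Icc 0 T) :
    (u t - v t) ^ 2 + (u' t - v' t) ^ 2 ≤ (u 0 - v 0) ^ 2 * Real.exp ((1 + lam * L) * t) := by
  set K := 1 + lam * L with hK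
  have hanti : AntitoneOn
      (fun t => Real.exp (-(K * t)) * ((u t - v t) ^ 2 + (u' t - v' t) ^ 2)) (Icc 0 T) := by
    have hder (x : ℝ) (hx : x ∈ Ioo 0 T) : HasDerivAt
        (fun t => Real.exp (-(K * t)) * ((u t - v t) ^ 2 + (u' t - v' t) ^ 2))
        (Real.exp (-(K * x)) * (-K * ((u x - v x) ^ 2 + (u' x - v' x) ^ 2) +
          2 * (u x - v x) * (u' x - v' x) + 2 * (u' x - v' x) * (u'' x - v'' x))) x := by
      obtain ⟨h1, h2, -⟩ := hasDerivAt_of_mem hu hx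
      obtain ⟨h4, h5, -⟩ := hasDerivAt_of_mem hv hx
      have h7 := (((hasDerivAt_id x).const_mul K).neg.exp).mul
        (((h1.sub h4).pow 2).add ((h2.sub h5).pow 2))
      refine h7.congr_deriv ?_
      simp
      ring
    refine antitoneOn_of_deriv_nonpos (convex_Icc 0 T) ?_ ?_ ?_
    · have c1 := continuousOn_fst hu
      have c2 := hu.2.1
      have c3 := continuousOn_fst hv
      have c4 := hv.2.1
      fun_prop
    · rw [interior_Icc]
      exact fun x hx => (hder x hx).differentiableAt.differentiableWithinAt
    · rw [interior_Icc]
      intro x hx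
      rw [(hder x hx).deriv]
      obtain ⟨-, -, h3⟩ := hasDerivAt_of_mem hu hx
      obtain ⟨-, -, h6⟩ := hasDerivAt_of_mem hv hx
      refine mul_nonpos_of_nonneg_of_nonpos (Real.exp_pos _).le ?_
      have hl := hL (u x) (v x) (huR x (Ioo_subset_Icc_self hx)) (hvR x (Ioo_subset_Icc_self hx))
      set gu := |u x| ^ (q - 1) * u x - u x
      set gv := |v x| ^ (q - 1) * v x - v x
      set w := u x - v x
      set w' := u' x - v' x with hw'
      have e : u'' x - v'' x = -(h x * w') - lam * (gu - gv) := by rw [h3, h6, hw']; ring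
      rw [e]
      have b1 : -(w' * (gu - gv)) ≤ L * (|w| * |w'|) := by
        have : |w' * (gu - gv)| ≤ L * (|w| * |w'|) := by
          rw [abs_mul]; nlinarith [abs_nonneg w']
        linarith [neg_abs_le (w' * (gu - gv))]
      have b2 : 2 * (|w| * |w'|) ≤ w ^ 2 + w' ^ 2 := by
        rw [← sq_abs w, ← sq_abs w']; nlinarith [sq_nonneg (|w| - |w'|)]
      have b3 : 2 * w * w' ≤ w ^ 2 + w' ^ 2 := by nlinarith [sq_nonneg (w - w')]
      have b4 : 0 ≤ h x * w' ^ 2 := mul_nonneg (hh x hx) (sq_nonneg _)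
      have b5 := mul_le_mul_of_nonneg_left b2 hL0
      have b6 : lam * (2 * -(w' * (gu - gv))) ≤ lam * (L * (w ^ 2 + w' ^ 2)) :=
        mul_le_mul_of_nonneg_left (by linarith) hlam.le
      rw [hK]; nlinarith
  have := hanti (left_mem_Icc.2 (ht.1.trans ht.2)) ht ht.1
  simp only [hu0, hv0, mul_zero, neg_zero, Real.exp_zero, one_mul, sub_zero, ne_eq,
    OfNat.ofNat_ne_zero, not_false_eq_true, zero_pow, add_zero] at this
  rw [Real.exp_neg, inv_mul_le_iff₀ (Real.exp_pos _)] at this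
  linarith

lemma ne_zero {h : ℝ → ℝ} {lam q T : ℝ} (hlam : 0 < lam) (hq : 1 < q)
    (hc : ContinuousOn h (Ioc 0 T)) {u u' u'' : ℝ → ℝ}
    (hu : SolOn h lam q (Icc 0 T) (Ioc 0 T) u u' u'') (hu0 : u 0 ≠ 0) {t : ℝ}
    (ht : t ∈ Icc 0 T) : ¬ (u t = 0 ∧ u' t = 0) := by
  rintro ⟨hut, hut'⟩
  rcases ht.1.eq_or_lt with rfl | htpos
  · exact hu0 hut
  have c1 := continuousOn_fst hu
  have c2 := hu.2.1
  obtain ⟨R, hR⟩ := isCompact_Icc.exists_bound_of_continuousOn c1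
  obtain ⟨L, hL0, hL⟩ := exists_lipschitz_nonlinearity hq (R := R)
  have hzero (s : ℝ) (hs : s ∈ Ioc 0 t) : u s = 0 := by
    have hsub : Icc s t ⊆ Icc 0 T := Icc_subset_Icc hs.1.le ht.2
    obtain ⟨H, hH⟩ := (isCompact_Icc (a := s) (b := t)).exists_bound_of_continuousOn
      (hc.mono fun x hx => ⟨hs.1.trans_le hx.1, hx.2.trans ht.2⟩)
    have hH0 : 0 ≤ H := (norm_nonneg _).trans (hH s (left_mem_Icc.2 hs.2))
    set K := 1 + 2 * H + lam * L with hK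
    have hmono : MonotoneOn (fun t => Real.exp (K * t) * (u t ^ 2 + u' t ^ 2)) (Icc s t) := by
      have hder (x : ℝ) (hx : x ∈ Ioo 0 T) : HasDerivAt
          (fun t => Real.exp (K * t) * (u t ^ 2 + u' t ^ 2))
          (Real.exp (K * x) * (K * (u x ^ 2 + u' x ^ 2) +
            2 * u x * u' x + 2 * u' x * u'' x)) x := by
        obtain ⟨h1, h2, -⟩ := hasDerivAt_of_mem hu hx
        have h7 := (((hasDerivAt_id x).const_mul K).exp).mul ((h1.pow 2).add (h2.pow 2))
        refine h7.congr_deriv ?_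
        simp
        ring
      have hint : Ioo s t ⊆ Ioo 0 T := Ioo_subset_Ioo hs.1.le ht.2
      refine monotoneOn_of_deriv_nonneg (convex_Icc s t) ?_ ?_ ?_
      · have c3 := c1.mono hsub
        have c4 := c2.mono hsub
        fun_prop
      · rw [interior_Icc]
        exact fun x hx => (hder x (hint hx)).differentiableAt.differentiableWithinAt
      · rw [interior_Icc]
        intro x hx
        rw [(hder x (hint hx)).deriv]
        obtain ⟨-, -, h3⟩ := hasDerivAt_of_mem hu (hint hx)
        refine mul_nonneg (Real.exp_pos _).le ?_
        have hRx := hR x (hsub (Ioo_subset_Icc_self hx))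
        rw [Real.norm_eq_abs] at hRx
        have hHx := hH x (Ioo_subset_Icc_self hx)
        rw [Real.norm_eq_abs] at hHx
        have hl := hL (u x) 0 hRx (by simpa using (abs_nonneg _).trans hRx)
        simp only [mul_zero, sub_zero] at hl
        set gu := |u x| ^ (q - 1) * u x - u x
        rw [h3]
        have b1 : u' x * gu ≤ L * (|u x| * |u' x|) := by
          have : |u' x * gu| ≤ L * (|u x| * |u' x|) := by
            rw [abs_mul]; nlinarith [abs_nonneg (u' x)]
          linarith [le_abs_self (u' x * gu)]
        have b2 : 2 * (|u x| * |u' x|) ≤ u x ^ 2 + u' x ^ 2 := by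
          rw [← sq_abs (u x), ← sq_abs (u' x)]; nlinarith [sq_nonneg (|u x| - |u' x|)]
        have b3 : -(u x ^ 2 + u' x ^ 2) ≤ 2 * u x * u' x := by nlinarith [sq_nonneg (u x + u' x)]
        have b4 : h x * u' x ^ 2 ≤ H * u' x ^ 2 :=
          mul_le_mul_of_nonneg_right ((le_abs_self _).trans hHx) (sq_nonneg _)
        have b5 := mul_le_mul_of_nonneg_left b2 hL0
        have b6 : lam * (2 * (u' x * gu)) ≤ lam * (L * (u x ^ 2 + u' x ^ 2)) :=
          mul_le_mul_of_nonneg_left (by linarith) hlam.le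
        have b7 : 0 ≤ H * u x ^ 2 := mul_nonneg hH0 (sq_nonneg _)
        rw [hK]; nlinarith
    have := hmono (left_mem_Icc.2 hs.2) (right_mem_Icc.2 hs.2) hs.2
    simp only [hut, hut', ne_eq, OfNat.ofNat_ne_zero, not_false_eq_true, zero_pow, add_zero,
      mul_zero] at this
    have h8 : u s ^ 2 + u' s ^ 2 ≤ 0 := by
      by_contra! hlt
      exact absurd (mul_pos (Real.exp_pos (K * s)) hlt) (by linarith)
    exact pow_eq_zero_iff (two_ne_zero) |>.1 (by nlinarith [sq_nonneg (u s), sq_nonneg (u' s)])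
  have hlim : Tendsto u (nhdsWithin 0 (Ioc 0 t)) (nhds (u 0)) :=
    (c1 0 (left_mem_Icc.2 (ht.1.trans ht.2))).mono_left
      (nhdsWithin_mono _ fun x hx => ⟨hx.1.le, hx.2.trans ht.2⟩)
  have hlim0 : Tendsto u (nhdsWithin 0 (Ioc 0 t)) (nhds 0) :=
    tendsto_const_nhds.congr' (eventually_nhdsWithin_of_forall fun s hs => (hzero s hs).symm)
  have : (nhdsWithin (0 : ℝ) (Ioc 0 t)).NeBot := by
    rw [nhdsWithin_Ioc_eq_nhdsGT htpos]; infer_instance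
  exact hu0 (tendsto_nhds_unique hlim hlim0)

end SolOn

/-- A function that can cross zero only downwards stays negative once it is nonpositive. -/
lemma neg_of_nonpos_of_crossing_down {T : ℝ} {f : ℝ → ℝ} (hf : ContinuousOn f (Icc 0 T))
    (h0 : f 0 ≠ 0) (hT : f T ≠ 0)
    (hcross : ∀ t ∈ Ioo 0 T, f t = 0 →
      (∀ᶠ s in nhdsWithin t (Ioi t), f s < 0) ∧ ∀ᶠ s in nhdsWithin t (Iio t), 0 < f s)
    {t s : ℝ} (ht : 0 ≤ t) (hts : t < s) (hs : s ≤ T) (hft : f t ≤ 0) : f s < 0 := by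
  have hsub : Icc t s ⊆ Icc 0 T := Icc_subset_Icc ht hs
  have hcl : IsClosed ({x | f x ≤ 0} ∩ Icc t s) := by
    have := (hf.mono hsub).preimage_isClosed_of_isClosed isClosed_Icc (isClosed_Iic (a := (0 : ℝ)))
    rwa [inter_comm] at this
  have hle : Icc t s ⊆ {x | f x ≤ 0} := by
    refine hcl.Icc_subset_of_forall_mem_nhdsWithin hft fun x hx => ?_
    obtain ⟨hfx : f x ≤ 0, hxt, hxs⟩ := hx
    have hxT : x < T := hxs.trans_le hs
    rcases hfx.lt_or_eq with hlt | heq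
    · have hcw : Tendsto f (nhdsWithin x (Ioi x)) (nhds (f x)) := by
        have h1 := (hf x ⟨ht.trans hxt, hxT.le⟩).mono_left
          (nhdsWithin_mono x (Ioc_subset_Icc_self.trans (Icc_subset_Icc_left (ht.trans hxt))))
        rwa [nhdsWithin_Ioc_eq_nhdsGT hxT] at h1
      filter_upwards [hcw.eventually (eventually_lt_nhds hlt)] with y hy using le_of_lt hy
    · have hx0 : x ≠ 0 := by rintro rfl; exact h0 heq
      filter_upwards [(hcross x ⟨lt_of_le_of_ne (ht.trans hxt) hx0.symm, hxT⟩ heq).1] with y hy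
        using le_of_lt hy
  refine lt_of_le_of_ne (hle ⟨hts.le, le_rfl⟩) fun heq => ?_
  have hsT : s ≠ T := by rintro rfl; exact hT heq
  have hev := (hcross s ⟨ht.trans_lt hts, lt_of_le_of_ne hs hsT⟩ heq).2
  obtain ⟨y, hy, hyt⟩ := (hev.and (Ioo_mem_nhdsLT hts)).exists
  exact absurd (hle ⟨hyt.1.le, hyt.2.le⟩ : f y ≤ 0) (not_le.2 hy)

/-- In polar coordinates for `(u, u')`, the angle crosses the zeros of the cosine downwards. -/
lemma angle_crossing_down {T : ℝ} {u u' θ r : ℝ → ℝ}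
    (hder : ∀ t ∈ Ioo 0 T, HasDerivAt u (u' t) t) (hr : ∀ t ∈ Icc 0 T, 0 < r t)
    (hθ : ContinuousOn θ (Icc 0 T)) (hu : ∀ t ∈ Icc 0 T, u t = r t * Real.cos (θ t))
    (hu' : ∀ t ∈ Icc 0 T, u' t = r t * Real.sin (θ t)) {c : ℝ} (hc : Real.cos c = 0)
    {t : ℝ} (ht : t ∈ Ioo 0 T) (hft : θ t - c = 0) :
    (∀ᶠ s in nhdsWithin t (Ioi t), θ s - c < 0) ∧
      ∀ᶠ s in nhdsWithin t (Iio t), 0 < θ s - c := by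
  have hθt : θ t = c := by linarith
  have hsin : Real.sin c * Real.sin c = 1 := by nlinarith [Real.sin_sq_add_cos_sq c]
  have htI := Ioo_subset_Icc_self ht
  have hd : HasDerivAt (fun s => u s * Real.sin c) (r t) t := by
    refine ((hder t ht).mul_const (Real.sin c)).congr_deriv ?_
    rw [hu' t htI, hθt, mul_assoc, hsin, mul_one]
  have hsign := eventually_nhdsWithin_sign_eq_of_deriv_pos (f := fun s => u s * Real.sin c)
    (x₀ := t) (by rw [hd.deriv]; exact hr t htI) (by simp [hu t htI, hθt, hc])
  have hcont : ContinuousAt θ t := hθ.continuousAt (Icc_mem_nhds ht.1 ht.2)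
  have hnear : ∀ᶠ s in nhds t, |θ s - c| < Real.pi := by
    have : Tendsto (fun s => |θ s - c|) (nhds t) (nhds |θ t - c|) :=
      (hcont.sub continuousAt_const).abs
    rw [hft, abs_zero] at this
    exact this.eventually (eventually_lt_nhds Real.pi_pos)
  have hall : ∀ᶠ s in nhds t, (t < s → θ s - c < 0) ∧ (s < t → 0 < θ s - c) := by
    filter_upwards [hsign, hnear, Icc_mem_nhds ht.1 ht.2] with s h1 h2 h3
    have h4 : u s * Real.sin c = -(r s * Real.sin (θ s - c)) := by
      rw [hu s h3]
      have : Real.cos (θ s) = -(Real.sin c * Real.sin (θ s - c)) := by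
        conv_lhs => rw [show θ s = c + (θ s - c) by ring, Real.cos_add, hc]
        ring
      rw [this]
      linear_combination (-(r s * Real.sin (θ s - c))) * hsin
    rw [abs_lt] at h2
    have hrs := hr s h3
    refine ⟨fun hlt => ?_, fun hlt => ?_⟩
    · rw [sign_pos (sub_pos.2 hlt), sign_eq_one_iff, h4] at h1
      by_contra! hge
      nlinarith [Real.sin_nonneg_of_nonneg_of_le_pi hge h2.2.le]
    · rw [sign_neg (sub_neg.2 hlt), sign_eq_neg_one_iff, h4] at h1
      by_contra! hge
      nlinarith [Real.sin_nonpos_of_nonpos_of_neg_pi_le hge h2.1.le]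
  exact ⟨by filter_upwards [nhdsWithin_le_nhds hall, self_mem_nhdsWithin] with s h1 h2
            using h1.1 h2,
    by filter_upwards [nhdsWithin_le_nhds hall, self_mem_nhdsWithin] with s h1 h2 using h1.2 h2⟩

/-- The terminal angle of `(u, u')` determines the number of zeros of `u`. -/
lemma ncard_zeros_of_angle {T : ℝ} (hT : 0 < T) {u u' θ r : ℝ → ℝ}
    (hder : ∀ t ∈ Ioo 0 T, HasDerivAt u (u' t) t) (hr : ∀ t ∈ Icc 0 T, 0 < r t)
    (hθ : ContinuousOn θ (Icc 0 T)) (hθ0 : θ 0 = 0)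
    (hu : ∀ t ∈ Icc 0 T, u t = r t * Real.cos (θ t))
    (hu' : ∀ t ∈ Icc 0 T, u' t = r t * Real.sin (θ t)) {j : ℕ}
    (hlo : -((2 * (j : ℝ) + 1) * Real.pi / 2) < θ T)
    (hhi : θ T < -((2 * (j : ℝ) - 1) * Real.pi / 2)) :
    {t ∈ Ioo 0 T | u t = 0}.Finite ∧ {t ∈ Ioo 0 T | u t = 0}.ncard = j := by
  have hpi := Real.pi_pos
  set c : ℤ → ℝ := fun k => -((2 * (k : ℝ) + 1) * Real.pi / 2) with hc
  have hcos (k : ℤ) : Real.cos (c k) = 0 := by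
    rw [Real.cos_eq_zero_iff]; exact ⟨-k - 1, by simp only [hc]; push_cast; ring⟩
  have hanti (k l : ℤ) (hkl : k ≤ l) : c l ≤ c k := by
    have : (k : ℝ) ≤ l := by exact_mod_cast hkl
    simp only [hc]; nlinarith
  have hcneg (k : ℤ) (hk : 0 ≤ k) : c k < 0 := by
    have : (0 : ℝ) ≤ k := by exact_mod_cast hk
    simp only [hc]; nlinarith
  have hcpos (k : ℤ) (hk : k < 0) : 0 < c k := by
    have : (k : ℝ) ≤ -1 := by exact_mod_cast (show k ≤ -1 by omega)
    simp only [hc]; nlinarith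
  have hbelow (k : ℤ) (hk : k < j) : θ T < c k := by
    refine hhi.trans_le ((le_of_eq ?_).trans (hanti k (j - 1) (by omega)))
    simp only [hc]; push_cast; ring
  have habove (k : ℤ) (hk : (j : ℤ) ≤ k) : c k < θ T :=
    (hanti j k hk).trans_lt (by simpa [hc] using hlo)
  have hstep (k : ℤ) {t s : ℝ} (ht : 0 ≤ t) (hts : t < s) (hs : s ≤ T) (hle : θ t ≤ c k) :
      θ s < c k := by
    refine sub_neg.1 (neg_of_nonpos_of_crossing_down (f := fun x => θ x - c k)
      (hθ.sub continuousOn_const) ?_ ?_ (fun x hx hx0 =>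
        angle_crossing_down hder hr hθ hu hu' (hcos k) hx hx0) ht hts hs (sub_nonpos.2 hle))
    · rcases lt_or_ge k 0 with hk | hk
      · have := hcpos k hk; simp only [hθ0]; linarith
      · have := hcneg k hk; simp only [hθ0]; linarith
    · rcases lt_or_ge k j with hk | hk
      · exact (sub_neg.2 (hbelow k hk)).ne
      · exact (sub_pos.2 (habove k hk)).ne'
  have hex (k : ℕ) : ∃ t, k < j → t ∈ Ioo 0 T ∧ θ t = c k := by
    by_cases hk : k < j
    · obtain ⟨t, ht, htk⟩ := intermediate_value_Ioo' hT.le hθ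
        ⟨hbelow k (by exact_mod_cast hk), by rw [hθ0]; exact hcneg k (by positivity)⟩
      exact ⟨t, fun _ => ⟨ht, htk⟩⟩
    · exact ⟨0, fun hk' => absurd hk' hk⟩
  choose τ hτ using hex
  have himage : {t ∈ Ioo 0 T | u t = 0} = τ '' (Finset.range j : Set ℕ) := by
    ext t
    constructor
    · rintro ⟨ht, hut⟩
      have htI := Ioo_subset_Icc_self ht
      rw [hu t htI, mul_eq_zero, or_iff_right (hr t htI).ne', Real.cos_eq_zero_iff] at hut
      obtain ⟨m, hm⟩ := hut
      have hmc : θ t = c (-m - 1) := by rw [hm]; simp only [hc]; push_cast; ring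
      have hk0 : 0 ≤ -m - 1 := by
        by_contra! hk
        exact (hstep _ le_rfl ht.1 ht.2.le (by rw [hθ0]; exact (hcpos _ hk).le)).ne hmc
      have hkj : -m - 1 < j := by
        by_contra! hk
        exact (hstep _ ht.1.le ht.2 le_rfl hmc.le).not_gt (habove _ hk)
      obtain ⟨k, hk⟩ := Int.eq_ofNat_of_zero_le hk0
      rw [hk] at hmc hkj
      have hkj' : k < j := by exact_mod_cast hkj
      refine ⟨k, by simpa using hkj', ?_⟩
      obtain ⟨h1, h2⟩ := hτ k hkj'
      rcases lt_trichotomy (τ k) t with hlt | heq | hgt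
      · exact absurd hmc (hstep k h1.1.le hlt ht.2.le h2.le).ne
      · exact heq
      · exact absurd h2 (hstep k ht.1.le hgt h1.2.le hmc.le).ne
    · rintro ⟨k, hk, rfl⟩
      obtain ⟨h1, h2⟩ := hτ k (by simpa using hk)
      exact ⟨h1, by rw [hu _ (Ioo_subset_Icc_self h1), h2, hcos, mul_zero]⟩
  have hinj : InjOn τ (Finset.range j : Set ℕ) := by
    intro k hk l hl hkl
    have h1 := (hτ k (by simpa using hk)).2
    have h2 := (hτ l (by simpa using hl)).2
    rw [hkl, h2] at h1
    simp only [hc] at h1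
    have h3 : (l : ℝ) = k := by
      have := mul_right_cancel₀ hpi.ne' (show (l : ℝ) * Real.pi = k * Real.pi by
        push_cast at h1; linarith)
      exact this
    exact_mod_cast h3.symm
  rw [himage]
  exact ⟨(Finset.finite_toSet _).image _, by
    rw [hinj.ncard_image, ncard_coe_finset, Finset.card_range]⟩

lemma exists_continuous_angle (F : C(ℝ × ℝ, ℂ)) (hF : ∀ p, F p ≠ 0) (hF0 : F (0, 0) = 1) :
    ∃ θ : ℝ × ℝ → ℝ, Continuous θ ∧ θ (0, 0) = 0 ∧
      ∀ p, (F p).re = ‖F p‖ * Real.cos (θ p) ∧ (F p).im = ‖F p‖ * Real.sin (θ p) := by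
  obtain ⟨Θ, ⟨h0, h1⟩, -⟩ := Complex.isCoveringMapOn_exp.existsUnique_continuousMap_lifts F
    (a₀ := (0, 0)) (e₀ := 0) (by simp [hF0]) (fun p => by simpa using hF p)
  refine ⟨fun p => (Θ p).im, by fun_prop, by simp [h0], fun p => ?_⟩
  rw [← h1]
  simp [Complex.norm_exp, Complex.exp_re, Complex.exp_im]

lemma eq_zero_of_cos_eq_one_s16 {g : ℝ → ℝ} (hg : Continuous g) (h0 : g 0 = 0)
    (hcos : ∀ s, Real.cos (g s) = 1) (s : ℝ) : g s = 0 := by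
  have key (f : ℝ → ℝ) (hf : Continuous f) (hf0 : f 0 = 0) (hfc : ∀ s, Real.cos (f s) = 1) :
      ¬ 0 < f s := by
    intro hpos
    have hpi := Real.pi_pos
    have hlt : Real.pi < f s := by
      by_contra! hle
      have := Real.cos_lt_cos_of_nonneg_of_le_pi le_rfl hle hpos
      rw [hfc, Real.cos_zero] at this
      exact lt_irrefl _ this
    obtain ⟨x, hx⟩ := mem_range_of_exists_le_of_exists_ge hf ⟨0, by rw [hf0]; exact hpi.le⟩ ⟨s, hlt.le⟩
    have := hfc x
    rw [hx, Real.cos_pi] at this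
    norm_num at this
  have h1 := key g hg h0 hcos
  have h2 := key (fun x => -g x) hg.neg (by simp [h0]) (fun x => by simp [hcos])
  linarith

/-- Solutions starting at rest depend continuously on the initial value, jointly with time. -/
lemma SolOn.continuousOn_uncurry {h : ℝ → ℝ} {lam q T : ℝ} (hlam : 0 < lam) (hq : 1 < q)
    (hh : ∀ t ∈ Ioo 0 T, 0 ≤ h t) {U U' U'' : ℝ → ℝ → ℝ}
    (hU : ∀ α : ℝ, SolOn h lam q (Icc 0 T) (Ioc 0 T) (U α) (U' α) (U'' α) ∧
      U α 0 = α ∧ U' α 0 = 0) :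
    ContinuousOn (fun p : ℝ × ℝ => (⟨U p.1 p.2, U' p.1 p.2⟩ : ℂ)) (univ ×ˢ Icc 0 T) := by
  rintro ⟨α, t⟩ ⟨-, ht⟩
  have hG : Continuous fun x : ℝ => |x| ^ (q + 1) / (q + 1) - x ^ 2 / 2 := by
    have : Continuous fun x : ℝ => |x| ^ (q + 1) :=
      continuous_abs.rpow_const fun _ => Or.inr (by linarith)
    fun_prop
  obtain ⟨M, hM⟩ := (isCompact_Icc (a := α - 1) (b := α + 1)).exists_bound_of_continuousOn
    hG.continuousOn
  obtain ⟨R, hR⟩ := SolOn.exists_bound_of_potential_le hq M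
  obtain ⟨L, hL0, hL⟩ := SolOn.exists_lipschitz_nonlinearity hq (R := R)
  have hbound (β : ℝ) (hβ : β ∈ Icc (α - 1) (α + 1)) (s : ℝ) (hs : s ∈ Icc 0 T) :
      |U β s| ≤ R := by
    obtain ⟨h1, h2, h3⟩ := hU β
    refine hR _ ((SolOn.potential_le hlam hq hh h1 h3 hs).trans ?_)
    rw [h2]
    exact (le_abs_self _).trans (hM β hβ)
  set C := Real.sqrt (Real.exp ((1 + lam * L) * T)) with hC
  have hlip (β : ℝ) (hβ : β ∈ Icc (α - 1) (α + 1)) (s : ℝ) (hs : s ∈ Icc 0 T) :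
      dist (⟨U β s, U' β s⟩ : ℂ) ⟨U α s, U' α s⟩ ≤ |β - α| * C := by
    obtain ⟨h1, h2, h3⟩ := hU β
    obtain ⟨h4, h5, h6⟩ := hU α
    have := SolOn.sq_sub_add_sq_sub_le hlam hh hL0 hL h1 h4 h3 h6 (hbound β hβ)
      (hbound α ⟨by linarith, by linarith⟩) hs
    rw [Complex.dist_eq_re_im, hC, ← Real.sqrt_sq_eq_abs, ← Real.sqrt_mul (sq_nonneg _)]
    refine Real.sqrt_le_sqrt (this.trans ?_)
    rw [h2, h5]
    have hK : 0 ≤ 1 + lam * L := by positivity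
    exact mul_le_mul_of_nonneg_left
      (Real.exp_le_exp.2 (mul_le_mul_of_nonneg_left hs.2 hK)) (sq_nonneg _)
  have hz : ContinuousOn (fun s => (⟨U α s, U' α s⟩ : ℂ)) (Icc 0 T) := by
    have c1 := SolOn.continuousOn_fst (hU α).1
    have c2 := (hU α).1.2.1
    exact Complex.equivRealProdCLM.symm.continuous.comp_continuousOn (c1.prodMk c2)
  rw [ContinuousWithinAt, tendsto_iff_dist_tendsto_zero]
  set l := nhdsWithin (α, t) (univ ×ˢ Icc (0 : ℝ) T) with hl
  have hfst : Tendsto Prod.fst l (nhds α) := continuous_fst.continuousAt.mono_left nhdsWithin_le_nhds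
  have hsnd : Tendsto Prod.snd l (nhdsWithin t (Icc 0 T)) := by
    refine tendsto_nhdsWithin_iff.2
      ⟨continuous_snd.continuousAt.mono_left nhdsWithin_le_nhds, ?_⟩
    filter_upwards [self_mem_nhdsWithin] with p hp using hp.2
  have hlim1 : Tendsto (fun p : ℝ × ℝ => |p.1 - α| * C) l (nhds 0) := by
    have := ((hfst.sub_const α).abs).mul_const C
    simpa using this
  have hlim2 : Tendsto (fun p : ℝ × ℝ => dist (⟨U α p.2, U' α p.2⟩ : ℂ) ⟨U α t, U' α t⟩) l
      (nhds 0) :=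
    (tendsto_iff_dist_tendsto_zero.1 (hz t ht)).comp hsnd
  have hlim := hlim1.add hlim2
  rw [add_zero] at hlim
  refine squeeze_zero' (Eventually.of_forall fun _ => dist_nonneg) ?_ hlim
  filter_upwards [hfst.eventually (Icc_mem_nhds (show α - 1 < α by linarith)
    (show α < α + 1 by linarith)), self_mem_nhdsWithin] with p hp1 hp2
  exact (dist_triangle _ _ _).trans (add_le_add (hlip p.1 hp1 p.2 hp2.2) le_rfl)

theorem stmt_16
    (d lam : ℝ) (hd : 0 < d) (hlam : 0 < lam)
    (n m₁ m₂ : ℤ) (hn : 3 ≤ n)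
    (hm₁0 : 0 ≤ m₁) (hm₁n : m₁ ≤ n - 2) (hm₂0 : 0 ≤ m₂) (hm₂n : m₂ ≤ n - 2)
    (h : ℝ → ℝ) (hC1 : ContDiffOn ℝ 1 h (Set.Ioo 0 d))
    (hder : ∀ t ∈ Set.Ioo 0 d, deriv h t < 0)
    (hlim0 : Filter.Tendsto (fun t => t * h t) (nhdsWithin 0 (Set.Ioi 0))
      (nhds ((n : ℝ) - (m₁ : ℝ) - 1)))
    (hlimd : Filter.Tendsto (fun t => (t - d) * h t) (nhdsWithin d (Set.Iio d))
      (nhds ((n : ℝ) - (m₂ : ℝ) - 1)))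
    (q : ℝ) (hq1 : 1 < q)
    (t₀ : ℝ) (ht₀ : t₀ ∈ Set.Ioo 0 d)
    (hpos : ∀ t ∈ Set.Ioo 0 t₀, 0 < h t) (hneg : ∀ t ∈ Set.Ioo t₀ d, h t < 0)
    (U U' U'' : ℝ → ℝ → ℝ)
    (hU : ∀ α : ℝ, SolOn h lam q (Set.Icc 0 t₀) (Set.Ioc 0 t₀) (U α) (U' α) (U'' α) ∧
      U α 0 = α ∧ U' α 0 = 0)
    (hUuniq : ∀ α : ℝ, ∀ u u' u'' : ℝ → ℝ,
      SolOn h lam q (Set.Icc 0 t₀) (Set.Ioc 0 t₀) u u' u'' → u 0 = α → u' 0 = 0 →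
      ∀ t ∈ Set.Icc 0 t₀, u t = U α t ∧ u' t = U' α t)
    (a : ℝ → ℝ) (haCont : ContinuousOn a (Set.Ioi 0)) (ha1 : a 1 = 0)
    (haAngle : ∀ α : ℝ, 0 < α →
      U α t₀ = enorm2 (U α t₀, U' α t₀) * Real.cos (a α) ∧
      U' α t₀ = enorm2 (U α t₀, U' α t₀) * Real.sin (a α))
    (α : ℝ) (hα : 0 < α) (j : ℕ)
    (hlo : -((2 * (j : ℝ) + 1) * Real.pi / 2) < a α)
    (hhi : a α < -((2 * (j : ℝ) - 1) * Real.pi / 2)) :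
    {t ∈ Set.Ioo 0 t₀ | U α t = 0}.Finite ∧
    {t ∈ Set.Ioo 0 t₀ | U α t = 0}.ncard = j ∧
    U α t₀ ≠ 0 ∧ Real.sign (U α t₀) = (-1 : ℝ) ^ j := by
  have hT : 0 < t₀ := ht₀.1
  have hh (t : ℝ) (ht : t ∈ Ioo 0 t₀) : 0 ≤ h t := (hpos t ht).le
  have hc : ContinuousOn h (Ioc 0 t₀) :=
    hC1.continuousOn.mono fun t ht => ⟨ht.1, ht.2.trans_lt ht₀.2⟩
  set π₀ : ℝ → ℝ := fun t => max 0 (min t t₀) with hπ₀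
  have hmem (t : ℝ) : π₀ t ∈ Icc 0 t₀ := ⟨le_max_left _ _, max_le hT.le (min_le_right _ _)⟩
  have hπ (t : ℝ) (ht : t ∈ Icc 0 t₀) : π₀ t = t := by
    simp only [hπ₀]; rw [min_eq_left ht.2, max_eq_right ht.1]
  have hcont : Continuous fun p : ℝ × ℝ =>
      (⟨U (Real.exp p.1) (π₀ p.2), U' (Real.exp p.1) (π₀ p.2)⟩ : ℂ) :=
    (SolOn.continuousOn_uncurry hlam hq1 hh hU).comp_continuous
      (f := fun p : ℝ × ℝ => (Real.exp p.1, π₀ p.2)) (by fun_prop) fun p => ⟨mem_univ _, hmem _⟩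
  have hone (t : ℝ) (ht : t ∈ Icc 0 t₀) : U 1 t = 1 ∧ U' 1 t = 0 := by
    have hs : SolOn h lam q (Icc 0 t₀) (Ioc 0 t₀) (fun _ => 1) (fun _ => 0) (fun _ => 0) :=
      ⟨fun t _ => hasDerivWithinAt_const _ _ _, continuousOn_const,
        fun t _ => hasDerivWithinAt_const _ _ _, continuousOn_const, fun t _ => by simp⟩
    obtain ⟨h1, h2⟩ := hUuniq 1 _ _ _ hs rfl rfl t ht
    exact ⟨h1.symm, h2.symm⟩
  have hne (p : ℝ × ℝ) :
      (⟨U (Real.exp p.1) (π₀ p.2), U' (Real.exp p.1) (π₀ p.2)⟩ : ℂ) ≠ 0 := by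
    obtain ⟨h1, h2, -⟩ := hU (Real.exp p.1)
    intro h0
    exact SolOn.ne_zero hlam hq1 hc h1 (by rw [h2]; exact (Real.exp_pos _).ne') (hmem p.2)
      (by simpa [Complex.ext_iff] using h0)
  obtain ⟨θ, hθ, hθ0, hpolar⟩ := exists_continuous_angle ⟨_, hcont⟩ hne (by
    obtain ⟨h1, h2⟩ := hone (π₀ 0) (hmem 0)
    simp [h1, h2, Complex.ext_iff])
  simp only [ContinuousMap.coe_mk] at hpolar
  have hθs (s : ℝ) : θ (s, 0) = 0 := by
    refine eq_zero_of_cos_eq_one_s16 (g := fun s => θ (s, 0)) (by fun_prop) hθ0 (fun s => ?_) s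
    obtain ⟨h1, -⟩ := hpolar (s, 0)
    obtain ⟨-, h2, h3⟩ := hU (Real.exp s)
    rw [show ((s, 0) : ℝ × ℝ).2 = 0 from rfl, show ((s, 0) : ℝ × ℝ).1 = s from rfl,
      hπ 0 ⟨le_rfl, hT.le⟩, h2, h3] at h1
    have h4 : ‖(⟨Real.exp s, 0⟩ : ℂ)‖ = Real.exp s := by
      rw [show (⟨Real.exp s, 0⟩ : ℂ) = ((Real.exp s : ℝ) : ℂ) from rfl, Complex.norm_real,
        Real.norm_eq_abs, abs_of_pos (Real.exp_pos _)]
    rw [h4] at h1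
    exact (mul_eq_left₀ (Real.exp_pos s).ne').1 h1.symm
  have hθt (t : ℝ) : θ (0, t) = 0 := by
    refine eq_zero_of_cos_eq_one_s16 (g := fun t => θ (0, t)) (by fun_prop) hθ0 (fun t => ?_) t
    obtain ⟨h1, -⟩ := hpolar (0, t)
    obtain ⟨h2, h3⟩ := hone (π₀ t) (hmem t)
    rw [show ((0, t) : ℝ × ℝ).2 = t from rfl, show ((0, t) : ℝ × ℝ).1 = 0 from rfl,
      Real.exp_zero, h2, h3, show (⟨1, 0⟩ : ℂ) = 1 from rfl, norm_one, one_mul] at h1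
    exact h1.symm
  have hθa (s : ℝ) : θ (s, t₀) - a (Real.exp s) = 0 := by
    refine eq_zero_of_cos_eq_one_s16 (g := fun s => θ (s, t₀) - a (Real.exp s)) ?_ ?_ (fun s => ?_) s
    · exact (by fun_prop : Continuous fun s => θ (s, t₀)).sub
        (haCont.comp_continuous Real.continuous_exp Real.exp_pos)
    · simp [hθt, ha1]
    · have h1 := hpolar (s, t₀)
      have h0 := hne (s, t₀)
      simp only [hπ t₀ ⟨hT.le, le_rfl⟩] at h1 h0
      have hnorm : enorm2 (U (Real.exp s) t₀, U' (Real.exp s) t₀) =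
          ‖(⟨U (Real.exp s) t₀, U' (Real.exp s) t₀⟩ : ℂ)‖ := by
        rw [Complex.norm_eq_sqrt_sq_add_sq, enorm2]
      obtain ⟨h2, h3⟩ := haAngle (Real.exp s) (Real.exp_pos s)
      rw [hnorm] at h2 h3
      have h4 := norm_ne_zero_iff.2 h0
      have hcos := mul_left_cancel₀ h4 (h1.1.symm.trans h2)
      have hsin := mul_left_cancel₀ h4 (h1.2.symm.trans h3)
      rw [Real.cos_sub, hcos, hsin]
      nlinarith [Real.sin_sq_add_cos_sq (a (Real.exp s))]
  have hexp : Real.exp (Real.log α) = α := Real.exp_log hα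
  have hend : θ (Real.log α, t₀) = a α := by
    have := hθa (Real.log α)
    rw [hexp] at this
    linarith
  have hpol (t : ℝ) (ht : t ∈ Icc 0 t₀) :
      0 < ‖(⟨U α t, U' α t⟩ : ℂ)‖ ∧
      U α t = ‖(⟨U α t, U' α t⟩ : ℂ)‖ * Real.cos (θ (Real.log α, t)) ∧
      U' α t = ‖(⟨U α t, U' α t⟩ : ℂ)‖ * Real.sin (θ (Real.log α, t)) := by
    have h1 := hpolar (Real.log α, t)
    have h0 := hne (Real.log α, t)
    simp only [hexp, hπ t ht] at h1 h0
    exact ⟨norm_pos_iff.2 h0, h1⟩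
  obtain ⟨hfin, hcard⟩ := ncard_zeros_of_angle (θ := fun t => θ (Real.log α, t)) hT
    (fun t ht => (SolOn.hasDerivAt_of_mem (hU α).1 ht).1) (fun t ht => (hpol t ht).1)
    (by fun_prop) (hθs _) (fun t ht => (hpol t ht).2.1) (fun t ht => (hpol t ht).2.2)
    (by rw [hend]; exact hlo) (by rw [hend]; exact hhi)
  obtain ⟨hrpos, hre, -⟩ := hpol t₀ ⟨hT.le, le_rfl⟩
  rw [hend] at hre
  have hcospos : 0 < Real.cos (a α + j * Real.pi) :=
    Real.cos_pos_of_mem_Ioo ⟨by linarith, by linarith⟩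
  rw [Real.cos_add_nat_mul_pi] at hcospos
  have hsgn : Real.sign (U α t₀) = (-1 : ℝ) ^ j := by
    rw [hre]
    rcases neg_one_pow_eq_or ℝ j with hj | hj
    · rw [hj] at hcospos ⊢
      exact Real.sign_of_pos (mul_pos hrpos (by linarith))
    · rw [hj] at hcospos ⊢
      exact Real.sign_of_neg (mul_neg_of_pos_of_neg hrpos (by linarith))
  refine ⟨hfin, hcard, fun h0 => ?_, hsgn⟩
  rw [h0, Real.sign_zero] at hsgn
  exact pow_ne_zero j (by norm_num) hsgn.symm
end
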